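/- arXiv:2201.02758 — 9 statements merged into one kernel-verified Lean document; each statement's English description precedes it below -/
import Mathlib

section
/- Let q be a prime power, k ≥ 3 an integer, h = 0, t = k−1, η ∈ 𝔽_q^*, and let α = (α_{i_1},…,α_{i_n}) be a vector of pairwise distinct elements of 𝔽_q with k+t = 2k−1 ≤ n ≤ q. Then the Schur square C²_{V_{k,k−1,0,η}}(α,1) of the TRS code C_{V_{k,k−1,0,η}}(α,1) ⊆ 𝔽_q^n equals the 𝔽_q-linear span of the vectors α^s for s ∈ {0,1,…,3k−3} \ {0,1,2k−1}, together with the two vectors α + η·α^{2k−1} and 1 + η²·α^{4k−4}. -/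
open Polynomial

noncomputable section

/-- The set of `(k,t,h,η)`-twisted polynomials
`V_{k,t,h,η} = { ∑_{i<k} a_i x^i + η a_h x^(k-1+t) }`. -/
def twistedPolySet (F : Type) [Field F] (k t h : ℕ) (η : F) : Set (Polynomial F) :=
  { f | ∃ a : ℕ → F,
      f = (∑ i ∈ Finset.range k, Polynomial.C (a i) * Polynomial.X ^ i)
          + Polynomial.C (η * a h) * Polynomial.X ^ (k - 1 + t) }

/-- The evaluation code `C_V(α, v) = { (v_j f(α_j))_j : f ∈ V }`. -/
def evalCode {F : Type} [Field F] {n : ℕ} (V : Set (Polynomial F)) (α v : Fin n → F) :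
    Set (Fin n → F) :=
  { c | ∃ f ∈ V, c = fun j => v j * f.eval (α j) }

/-- The standard code: evaluation (with coefficients 1) at all elements of `F`. -/
def stdCode (F : Type) [Field F] (V : Set (Polynomial F)) : Set (F → F) :=
  { c | ∃ f ∈ V, c = fun x => f.eval x }

/-- The Schur square `C² = span { c₁ * c₂ : c₁, c₂ ∈ C }` (coordinatewise product). -/
def schurSq {F : Type} [Field F] {ι : Type} (C : Set (ι → F)) : Submodule F (ι → F) :=
  Submodule.span F { x | ∃ c₁ ∈ C, ∃ c₂ ∈ C, x = c₁ * c₂ }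

/-- The (Euclidean) dual code. -/
def dualCode {F : Type} [Field F] {ι : Type} [Fintype ι] (C : Set (ι → F)) : Set (ι → F) :=
  { x | ∀ c ∈ C, ∑ j, x j * c j = 0 }

/-- A code is self-orthogonal if it is contained in its dual. -/
def SelfOrthogonal {F : Type} [Field F] {ι : Type} [Fintype ι] (C : Set (ι → F)) : Prop :=
  C ⊆ dualCode C

/-- The spanning family `1 + η α^(2k-2), α, α^2, …` of the code `C_V(α, 1)` for `t = k - 1`,
`h = 0`. -/
def twistedBasis {F : Type} [Field F] {n : ℕ} (k : ℕ) (η : F) (α : Fin n → F) (i : ℕ) :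
    Fin n → F :=
  if i = 0 then 1 + η • α ^ (2 * k - 2) else α ^ i

theorem twistedBasis_zero {F : Type} [Field F] {n : ℕ} (k : ℕ) (η : F) (α : Fin n → F) :
    twistedBasis k η α 0 = 1 + η • α ^ (2 * k - 2) := if_pos rfl

theorem twistedBasis_of_ne_zero {F : Type} [Field F] {n : ℕ} (k : ℕ) (η : F) (α : Fin n → F)
    {i : ℕ} (hi : i ≠ 0) : twistedBasis k η α i = α ^ i := if_neg hi

theorem mem_evalCode_twistedPolySet_iff {F : Type} [Field F] {n k : ℕ} (hk : 1 ≤ k) (η : F)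
    (α c : Fin n → F) :
    c ∈ evalCode (twistedPolySet F k (k - 1) 0 η) α 1 ↔
      ∃ a : ℕ → F, c = ∑ i ∈ Finset.range k, a i • twistedBasis k η α i := by
  obtain ⟨m, rfl⟩ : ∃ m, k = m + 1 := ⟨k - 1, by omega⟩
  have hexp : m + 1 - 1 + (m + 1 - 1) = 2 * (m + 1) - 2 := by omega
  have key (a : ℕ → F) :
      (fun j => (1 : Fin n → F) j * eval (α j)
        ((∑ i ∈ Finset.range (m + 1), C (a i) * X ^ i)
          + C (η * a 0) * X ^ (m + 1 - 1 + (m + 1 - 1)))) =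
        ∑ i ∈ Finset.range (m + 1), a i • twistedBasis (m + 1) η α i := by
    funext j
    rw [hexp, Finset.sum_range_succ', Finset.sum_range_succ', twistedBasis_zero]
    simp only [twistedBasis_of_ne_zero _ _ _ (Nat.succ_ne_zero _), eval_add, eval_finsetSum,
      eval_mul, eval_C, eval_pow, eval_X, Pi.one_apply, Pi.add_apply, Finset.sum_apply,
      Pi.smul_apply, Pi.pow_apply, smul_eq_mul]
    ring
  constructor
  · rintro ⟨f, ⟨a, rfl⟩, rfl⟩
    exact ⟨a, key a⟩
  · rintro ⟨a, rfl⟩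
    exact ⟨_, ⟨a, rfl⟩, (key a).symm⟩

theorem twistedBasis_mem_evalCode {F : Type} [Field F] {n k : ℕ} (η : F) (α : Fin n → F)
    {i : ℕ} (hi : i < k) :
    twistedBasis k η α i ∈ evalCode (twistedPolySet F k (k - 1) 0 η) α 1 := by
  rw [mem_evalCode_twistedPolySet_iff (by omega)]
  exact ⟨Pi.single i 1, by simp [Pi.single_apply, ite_smul, hi]⟩

theorem schurSq_evalCode_twistedPolySet_le_iff {F : Type} [Field F] {n k : ℕ} (hk : 1 ≤ k)
    (η : F) (α : Fin n → F) (W : Submodule F (Fin n → F)) :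
    schurSq (evalCode (twistedPolySet F k (k - 1) 0 η) α 1) ≤ W ↔
      ∀ i < k, ∀ j < k, twistedBasis k η α i * twistedBasis k η α j ∈ W := by
  constructor
  · intro h i hi j hj
    exact h (Submodule.subset_span ⟨_, twistedBasis_mem_evalCode η α hi, _,
      twistedBasis_mem_evalCode η α hj, rfl⟩)
  · intro h
    refine Submodule.span_le.2 ?_
    rintro _ ⟨c₁, h₁, c₂, h₂, rfl⟩
    obtain ⟨a, rfl⟩ := (mem_evalCode_twistedPolySet_iff hk η α c₁).1 h₁
    obtain ⟨b, rfl⟩ := (mem_evalCode_twistedPolySet_iff hk η α c₂).1 h₂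
    rw [Finset.sum_mul_sum]
    refine Submodule.sum_mem _ fun i hi => Submodule.sum_mem _ fun j hj => ?_
    rw [smul_mul_smul_comm]
    exact W.smul_mem _ (h i (Finset.mem_range.1 hi) j (Finset.mem_range.1 hj))

theorem stmt_0 (F : Type) [Field F] [Fintype F] (q k n : ℕ)
    (hq : Fintype.card F = q) (hk : 3 ≤ k)
    (η : F) (hη : η ≠ 0)
    (α : Fin n → F) (hα : Function.Injective α)
    (hn1 : 2 * k - 1 ≤ n) (hn2 : n ≤ q) :
    schurSq (evalCode (twistedPolySet F k (k - 1) 0 η) α 1) =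
      Submodule.span F
        (((fun s : ℕ => fun j : Fin n => α j ^ s) ''
            {s : ℕ | s ≤ 3 * k - 3 ∧ s ≠ 0 ∧ s ≠ 1 ∧ s ≠ 2 * k - 1}) ∪
          {fun j : Fin n => α j + η * α j ^ (2 * k - 1),
           fun j : Fin n => 1 + η ^ 2 * α j ^ (4 * k - 4)}) := by
  have g_mul {i m : ℕ} (hm : 2 * k - 2 + i = m) :
      twistedBasis k η α 0 * α ^ i = α ^ i + η • α ^ m := by
    rw [twistedBasis_zero, add_mul, one_mul, smul_mul_assoc, ← pow_add, hm]
  have g_sq : twistedBasis k η α 0 * twistedBasis k η α 0 =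
      (fun j : Fin n => 1 + η ^ 2 * α j ^ (4 * k - 4)) + (2 * η) • α ^ (2 * k - 2) := by
    have h4 : 4 * k - 4 = (2 * k - 2) + (2 * k - 2) := by omega
    funext j
    simp only [twistedBasis_zero, h4, Pi.mul_apply, Pi.add_apply, Pi.smul_apply, Pi.pow_apply,
      Pi.one_apply, smul_eq_mul]
    ring
  apply le_antisymm
  · set W := Submodule.span F
      (((fun s : ℕ => fun j : Fin n => α j ^ s) ''
          {s : ℕ | s ≤ 3 * k - 3 ∧ s ≠ 0 ∧ s ≠ 1 ∧ s ≠ 2 * k - 1}) ∪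
        {fun j : Fin n => α j + η * α j ^ (2 * k - 1),
         fun j : Fin n => 1 + η ^ 2 * α j ^ (4 * k - 4)})
    have pow_mem {s : ℕ} (h1 : s ≤ 3 * k - 3) (h2 : 2 ≤ s) (h3 : s ≠ 2 * k - 1) :
        α ^ s ∈ W :=
      Submodule.subset_span (Or.inl ⟨s, ⟨h1, by omega, by omega, h3⟩, rfl⟩)
    have g_mul_mem {i : ℕ} (h0 : i ≠ 0) (hi : i < k) : twistedBasis k η α 0 * α ^ i ∈ W := by
      rw [g_mul rfl]
      rcases eq_or_ne i 1 with rfl | h1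
      · have h : α ^ 1 + η • α ^ (2 * k - 2 + 1) =
            fun j : Fin n => α j + η * α j ^ (2 * k - 1) := by
          rw [show 2 * k - 2 + 1 = 2 * k - 1 by omega, pow_one]
          rfl
        rw [h]
        exact Submodule.subset_span (Or.inr (Or.inl rfl))
      · exact W.add_mem (pow_mem (by omega) (by omega) (by omega))
          (W.smul_mem _ (pow_mem (by omega) (by omega) (by omega)))
    rw [schurSq_evalCode_twistedPolySet_le_iff (by omega)]
    intro i hi j hj
    rcases eq_or_ne i 0 with rfl | hi0 <;> rcases eq_or_ne j 0 with rfl | hj0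
    · rw [g_sq]
      exact W.add_mem (Submodule.subset_span (Or.inr (Or.inr rfl)))
        (W.smul_mem _ (pow_mem (by omega) (by omega) (by omega)))
    · rw [twistedBasis_of_ne_zero _ _ _ hj0]
      exact g_mul_mem hj0 hj
    · rw [twistedBasis_of_ne_zero _ _ _ hi0, mul_comm]
      exact g_mul_mem hi0 hi
    · rw [twistedBasis_of_ne_zero _ _ _ hi0, twistedBasis_of_ne_zero _ _ _ hj0, ← pow_add]
      exact pow_mem (by omega) (by omega) (by omega)
  · set S := schurSq (evalCode (twistedPolySet F k (k - 1) 0 η) α 1) with hS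
    have mul_mem := (schurSq_evalCode_twistedPolySet_le_iff (by omega) η α S).1 hS.ge
    have low_mem {s : ℕ} (h1 : 2 ≤ s) (h2 : s ≤ 2 * k - 2) : α ^ s ∈ S := by
      obtain ⟨i, j, hi, hj, hi0, hj0, rfl⟩ :
          ∃ i j, i < k ∧ j < k ∧ i ≠ 0 ∧ j ≠ 0 ∧ s = i + j := by
        rcases le_total s k with h | h
        · exact ⟨1, s - 1, by omega, by omega, by omega, by omega, by omega⟩
        · exact ⟨k - 1, s - (k - 1), by omega, by omega, by omega, by omega, by omega⟩
      have h := mul_mem i hi j hj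
      rwa [twistedBasis_of_ne_zero _ _ _ hi0, twistedBasis_of_ne_zero _ _ _ hj0,
        ← pow_add] at h
    have g_mul_mem {i m : ℕ} (h0 : i ≠ 0) (hi : i < k) (hm : 2 * k - 2 + i = m) :
        α ^ i + η • α ^ m ∈ S := by
      have h := mul_mem 0 (by omega) i hi
      rwa [twistedBasis_of_ne_zero _ _ _ h0, g_mul hm] at h
    rw [Submodule.span_le]
    rintro _ (⟨s, ⟨h1, h2, h3, h4⟩, rfl⟩ | rfl | rfl)
    · change α ^ s ∈ S
      rcases le_or_gt s (2 * k - 2) with h | h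
      · exact low_mem (by omega) h
      · have hg := g_mul_mem (i := s - (2 * k - 2)) (m := s) (by omega) (by omega) (by omega)
        rwa [S.add_mem_iff_right (low_mem (by omega) (by omega)), S.smul_mem_iff hη] at hg
    · have hg := g_mul_mem (i := 1) (m := 2 * k - 1) one_ne_zero (by omega) (by omega)
      rwa [pow_one] at hg
    · have hg := mul_mem 0 (by omega) 0 (by omega)
      rwa [g_sq, S.add_mem_iff_left (S.smul_mem _ (low_mem (by omega) le_rfl))] at hg
end
end

section
/- Let q be a prime power, k ≥ 3 an integer, h = 0, t an integer with 1 ≤ t ≤ k−2, η ∈ 𝔽_q^*, and let α = (α_{i_1},…,α_{i_n}) be a vector of pairwise distinct elements of 𝔽_q with k+t ≤ n ≤ q. Then the Schur square C²_{V_{k,t,0,η}}(α,1) of the TRS code C_{V_{k,t,0,η}}(α,1) ⊆ 𝔽_q^n equals the 𝔽_q-linear span of the vectors α^s for s ∈ {1,2,…,2k−2+t}, together with the vector 1 + η²·α^{2k+2t−2}. -/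
open Polynomial

noncomputable section

open scoped Pointwise

/-- The vector `1 + η α^(k-1+t)`, the evaluation of the twisted basis polynomial for hook `0`. -/
def hookVec {F : Type} [Field F] {n : ℕ} (k t : ℕ) (η : F) (α : Fin n → F) : Fin n → F :=
  1 + η • α ^ (k - 1 + t)

/-- The evaluations of the standard basis of the twisted polynomials with hook `0`. -/
def twistedGens {F : Type} [Field F] {n : ℕ} (k t : ℕ) (η : F) (α : Fin n → F) :
    Set (Fin n → F) :=
  insert (hookVec k t η α) ((fun s : ℕ => α ^ s) '' {s | 1 ≤ s ∧ s < k})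

theorem hookVec_mem_evalCode {F : Type} [Field F] {n k : ℕ} (hk : 1 ≤ k) (t : ℕ) (η : F)
    (α : Fin n → F) : hookVec k t η α ∈ evalCode (twistedPolySet F k t 0 η) α 1 := by
  refine ⟨_, ⟨Pi.single 0 1, rfl⟩, ?_⟩
  funext j
  have h0 : 0 < k := hk
  simp [hookVec, Pi.single_apply, h0]

theorem pow_mem_evalCode {F : Type} [Field F] {n k s : ℕ} (hs : 1 ≤ s) (hsk : s < k) (t : ℕ)
    (η : F) (α : Fin n → F) : α ^ s ∈ evalCode (twistedPolySet F k t 0 η) α 1 := by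
  refine ⟨_, ⟨Pi.single s 1, rfl⟩, ?_⟩
  funext j
  have h0 : (0 : ℕ) ≠ s := by omega
  simp [Pi.single_apply, hsk, h0]

theorem evalCode_subset_span {F : Type} [Field F] {n k : ℕ} (hk : 1 ≤ k) (t : ℕ) (η : F)
    (α : Fin n → F) :
    evalCode (twistedPolySet F k t 0 η) α 1 ⊆ Submodule.span F (twistedGens k t η α) := by
  rintro c ⟨f, ⟨a, rfl⟩, rfl⟩
  obtain ⟨k, rfl⟩ : ∃ m, k = m + 1 := ⟨k - 1, by omega⟩
  have h : (fun j => (1 : Fin n → F) j *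
      ((∑ i ∈ Finset.range (k + 1), C (a i) * X ^ i)
        + C (η * a 0) * X ^ (k + 1 - 1 + t)).eval (α j)) =
      a 0 • hookVec (k + 1) t η α + ∑ i ∈ Finset.range k, a (i + 1) • α ^ (i + 1) := by
    funext j
    simp [hookVec, eval_finsetSum, Finset.sum_range_succ', Finset.sum_apply]
    ring
  rw [h]
  refine add_mem (Submodule.smul_mem _ _ (Submodule.subset_span (Set.mem_insert _ _)))
    (sum_mem fun i hi => Submodule.smul_mem _ _ (Submodule.subset_span (Set.mem_insert_of_mem _
      ⟨i + 1, ⟨by omega, ?_⟩, rfl⟩)))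
  have := Finset.mem_range.1 hi
  omega

theorem schurSq_evalCode_eq_span {F : Type} [Field F] {n k : ℕ} (hk : 1 ≤ k) (t : ℕ) (η : F)
    (α : Fin n → F) :
    schurSq (evalCode (twistedPolySet F k t 0 η) α 1) =
      Submodule.span F (twistedGens k t η α * twistedGens k t η α) := by
  have hsub : twistedGens k t η α ⊆ evalCode (twistedPolySet F k t 0 η) α 1 := by
    rintro _ (rfl | ⟨s, ⟨h1, h2⟩, rfl⟩)
    · exact hookVec_mem_evalCode hk t η α
    · exact pow_mem_evalCode h1 h2 t η α
  apply le_antisymm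
  · refine Submodule.span_le.2 ?_
    rintro _ ⟨c₁, h₁, c₂, h₂, rfl⟩
    rw [← Submodule.span_mul_span]
    exact Submodule.mul_mem_mul (evalCode_subset_span hk t η α h₁)
      (evalCode_subset_span hk t η α h₂)
  · refine Submodule.span_mono ?_
    rintro _ ⟨c₁, h₁, c₂, h₂, rfl⟩
    exact ⟨c₁, hsub h₁, c₂, hsub h₂, rfl⟩

theorem hookVec_mul_pow {F : Type} [Field F] {n : ℕ} (k t s : ℕ) (η : F) (α : Fin n → F) :
    hookVec k t η α * α ^ s = α ^ s + η • α ^ (k - 1 + t + s) := by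
  rw [hookVec, add_mul, one_mul, smul_mul_assoc, ← pow_add]

theorem hookVec_mul_self {F : Type} [Field F] {n k : ℕ} (hk : 1 ≤ k) (t : ℕ) (η : F)
    (α : Fin n → F) :
    hookVec k t η α * hookVec k t η α =
      (fun j => 1 + η ^ 2 * α j ^ (2 * k + 2 * t - 2)) + (2 * η) • α ^ (k - 1 + t) := by
  have e : 2 * k + 2 * t - 2 = (k - 1 + t) * 2 := by omega
  funext j
  simp only [hookVec, e, Pi.add_apply, Pi.mul_apply, Pi.smul_apply, Pi.pow_apply, Pi.one_apply,
    smul_eq_mul, pow_mul]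
  ring

theorem stmt_1 (F : Type) [Field F] [Fintype F] (q k t n : ℕ)
    (hq : Fintype.card F = q) (hk : 3 ≤ k) (ht1 : 1 ≤ t) (ht2 : t ≤ k - 2)
    (η : F) (hη : η ≠ 0)
    (α : Fin n → F) (hα : Function.Injective α)
    (hn1 : k + t ≤ n) (hn2 : n ≤ q) :
    schurSq (evalCode (twistedPolySet F k t 0 η) α 1) =
      Submodule.span F
        (((fun s : ℕ => fun j : Fin n => α j ^ s) ''
            {s : ℕ | 1 ≤ s ∧ s ≤ 2 * k - 2 + t}) ∪
          {fun j : Fin n => 1 + η ^ 2 * α j ^ (2 * k + 2 * t - 2)}) := by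
  have hk1 : 1 ≤ k := by omega
  rw [schurSq_evalCode_eq_span hk1]
  apply le_antisymm <;> refine Submodule.span_le.2 ?_
  · set W := Submodule.span F
        (((fun s : ℕ => fun j : Fin n => α j ^ s) ''
            {s : ℕ | 1 ≤ s ∧ s ≤ 2 * k - 2 + t}) ∪
          {fun j : Fin n => 1 + η ^ 2 * α j ^ (2 * k + 2 * t - 2)})
    have hpow (s : ℕ) (h1 : 1 ≤ s) (h2 : s ≤ 2 * k - 2 + t) : α ^ s ∈ W :=
      Submodule.subset_span (Or.inl ⟨s, ⟨h1, h2⟩, rfl⟩)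
    have hmix (s : ℕ) (h1 : 1 ≤ s) (h2 : s < k) : hookVec k t η α * α ^ s ∈ W := by
      rw [hookVec_mul_pow]
      exact add_mem (hpow _ h1 (by omega))
        (Submodule.smul_mem _ _ (hpow _ (by omega) (by omega)))
    rintro _ ⟨_, rfl | ⟨s, ⟨hs1, hs2⟩, rfl⟩, _, rfl | ⟨r, ⟨hr1, hr2⟩, rfl⟩, rfl⟩ <;> dsimp only
    · rw [hookVec_mul_self hk1]
      exact add_mem (Submodule.subset_span (Or.inr rfl))
        (Submodule.smul_mem _ _ (hpow _ (by omega) (by omega)))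
    · exact hmix r hr1 hr2
    · rw [mul_comm]
      exact hmix s hs1 hs2
    · rw [← pow_add]
      exact hpow _ (by omega) (by omega)
  · set S := Submodule.span F (twistedGens k t η α * twistedGens k t η α)
    have hhook : hookVec k t η α ∈ twistedGens k t η α := Set.mem_insert _ _
    have hgen (s : ℕ) (h1 : 1 ≤ s) (h2 : s < k) : α ^ s ∈ twistedGens k t η α :=
      Set.mem_insert_of_mem _ ⟨s, ⟨h1, h2⟩, rfl⟩
    have hmix (s : ℕ) (h1 : 1 ≤ s) (h2 : s < k) : α ^ s + η • α ^ (k - 1 + t + s) ∈ S := by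
      rw [← hookVec_mul_pow]
      exact Submodule.subset_span (Set.mul_mem_mul hhook (hgen s h1 h2))
    have hlow (s : ℕ) (h1 : 2 ≤ s) (h2 : s ≤ 2 * k - 2) : α ^ s ∈ S := by
      obtain ⟨i, j, hi, hi', hj, hj', rfl⟩ :
          ∃ i j, 1 ≤ i ∧ i < k ∧ 1 ≤ j ∧ j < k ∧ s = i + j := by
        by_cases h : s ≤ k
        · exact ⟨1, s - 1, by omega, by omega, by omega, by omega, by omega⟩
        · exact ⟨k - 1, s - (k - 1), by omega, by omega, by omega, by omega, by omega⟩
      rw [pow_add]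
      exact Submodule.subset_span (Set.mul_mem_mul (hgen i hi hi') (hgen j hj hj'))
    have hpow (s : ℕ) (h1 : 1 ≤ s) (h2 : s ≤ 2 * k - 2 + t) : α ^ s ∈ S := by
      rcases Nat.lt_or_ge s 2 with h | h
      · obtain rfl : s = 1 := by omega
        exact (Submodule.add_mem_iff_left _
          (Submodule.smul_mem _ η (hlow (k - 1 + t + 1) (by omega) (by omega)))).1
          (hmix 1 le_rfl (by omega))
      · by_cases h' : s ≤ 2 * k - 2
        · exact hlow s h h'
        · obtain ⟨i, rfl⟩ : ∃ i, s = k - 1 + t + i := ⟨s - (k - 1 + t), by omega⟩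
          exact (Submodule.smul_mem_iff _ hη).1 ((Submodule.add_mem_iff_right _
            (hlow i (by omega) (by omega))).1 (hmix i (by omega) (by omega)))
    rintro _ (⟨s, ⟨hs1, hs2⟩, rfl⟩ | rfl)
    · exact hpow s hs1 hs2
    · have hsq : hookVec k t η α * hookVec k t η α ∈ S :=
        Submodule.subset_span (Set.mul_mem_mul hhook hhook)
      rw [hookVec_mul_self hk1] at hsq
      exact (Submodule.add_mem_iff_left _
        (Submodule.smul_mem _ _ (hpow _ (by omega) (by omega)))).1 hsq
end
end

section
/- Let q be a prime power and k, t, h integers with k ≥ 3, t ≥ 1, h ≥ 0, t+h ≤ k−1, and η ∈ 𝔽_q^*. If (q−t+1)/2 < k ≤ q/2, then the Schur square C²_{V_{k,t,h,η}} of the standard TRS code C_{V_{k,t,h,η}} equals all of 𝔽_q^q. -/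
open Polynomial

noncomputable section

section PowerFunctions

variable {F : Type} [Field F]

lemma pow_mem_stdCode_twistedPolySet {k t h i : ℕ} (η : F) (hi : i < k) (hih : i ≠ h) :
    (fun x : F => x ^ i) ∈ stdCode F (twistedPolySet F k t h η) := by
  refine ⟨X ^ i, ⟨Pi.single i 1, ?_⟩, by simp⟩
  simp [Pi.single_apply, hih.symm, hi]

lemma twisted_pow_mem_stdCode_twistedPolySet {k h : ℕ} (t : ℕ) (η : F) (hh : h < k) :
    (fun x : F => x ^ h + η * x ^ (k - 1 + t)) ∈ stdCode F (twistedPolySet F k t h η) := by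
  refine ⟨X ^ h + C η * X ^ (k - 1 + t), ⟨Pi.single h 1, ?_⟩, by simp⟩
  simp [Pi.single_apply, hh]

lemma mul_mem_schurSq {ι : Type} {C : Set (ι → F)} {c₁ c₂ : ι → F} (h₁ : c₁ ∈ C) (h₂ : c₂ ∈ C) :
    c₁ * c₂ ∈ schurSq C :=
  Submodule.subset_span ⟨c₁, h₁, c₂, h₂, rfl⟩

lemma pow_add_mem_schurSq {k t h i j : ℕ} (η : F) (hi : i < k) (hih : i ≠ h) (hj : j < k)
    (hjh : j ≠ h) :
    (fun x : F => x ^ (i + j)) ∈ schurSq (stdCode F (twistedPolySet F k t h η)) := by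
  convert mul_mem_schurSq (pow_mem_stdCode_twistedPolySet (t := t) η hi hih)
    (pow_mem_stdCode_twistedPolySet (t := t) η hj hjh) using 1
  ext x
  simp [pow_add]

lemma pow_add_iff_mem_schurSq {k t h i : ℕ} {η : F} (hη : η ≠ 0) (hh : h < k) (hi : i < k)
    (hih : i ≠ h) :
    (fun x : F => x ^ (i + h)) ∈ schurSq (stdCode F (twistedPolySet F k t h η)) ↔
      (fun x : F => x ^ (i + (k - 1 + t))) ∈ schurSq (stdCode F (twistedPolySet F k t h η)) := by
  have key := mul_mem_schurSq (pow_mem_stdCode_twistedPolySet (t := t) η hi hih)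
    (twisted_pow_mem_stdCode_twistedPolySet t η hh)
  have split : (fun x : F => x ^ i) * (fun x : F => x ^ h + η * x ^ (k - 1 + t)) =
      (fun x : F => x ^ (i + h)) + η • (fun x : F => x ^ (i + (k - 1 + t))) := by
    ext x
    simp only [Pi.mul_apply, Pi.add_apply, Pi.smul_apply, smul_eq_mul]
    ring
  rw [split] at key
  constructor
  · intro H
    exact (Submodule.smul_mem_iff _ hη).1 ((Submodule.add_mem_iff_right _ H).1 key)
  · intro H
    exact (Submodule.add_mem_iff_left _ (Submodule.smul_mem _ _ H)).1 key

lemma pow_two_mul_mem_schurSq {k t h : ℕ} (η : F) (hh : h < k)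
    (h₁ : (fun x : F => x ^ (h + (k - 1 + t))) ∈ schurSq (stdCode F (twistedPolySet F k t h η)))
    (h₂ : (fun x : F => x ^ (2 * (k - 1 + t))) ∈ schurSq (stdCode F (twistedPolySet F k t h η))) :
    (fun x : F => x ^ (2 * h)) ∈ schurSq (stdCode F (twistedPolySet F k t h η)) := by
  have key := mul_mem_schurSq (twisted_pow_mem_stdCode_twistedPolySet t η hh)
    (twisted_pow_mem_stdCode_twistedPolySet t η hh)
  convert Submodule.sub_mem _ (Submodule.sub_mem _ key (Submodule.smul_mem _ (2 * η) h₁))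
    (Submodule.smul_mem _ (η ^ 2) h₂) using 1
  ext x
  simp only [Pi.mul_apply, Pi.sub_apply, Pi.smul_apply, smul_eq_mul]
  ring

lemma pow_mem_of_pow_mem_Icc [Fintype F] {S : Submodule F (F → F)}
    (H : ∀ s, 1 ≤ s → s ≤ Fintype.card F → (fun x : F => x ^ s) ∈ S) (s : ℕ) (hs : 1 ≤ s) :
    (fun x : F => x ^ s) ∈ S := by
  induction s using Nat.strong_induction_on with
  | _ s ih =>
    rcases le_or_gt s (Fintype.card F) with hle | hlt
    · exact H s hs hle
    · have hcard := Fintype.one_lt_card (α := F)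
      convert ih (s - Fintype.card F + 1) (by omega) (by omega) using 1
      ext x
      conv_lhs => rw [← Nat.sub_add_cancel hlt.le, pow_add, FiniteField.pow_card]
      rw [pow_succ]

lemma eq_top_of_forall_pow_mem [Fintype F] {S : Submodule F (F → F)}
    (H : ∀ s, (fun x : F => x ^ s) ∈ S) : S = ⊤ := by
  classical
  have hpoly (p : F[X]) : (fun x : F => p.eval x) ∈ S := by
    induction p using Polynomial.induction_on' with
    | add p q hp hq => simpa [Pi.add_def] using S.add_mem hp hq
    | monomial n a => simpa [Pi.smul_def] using S.smul_mem a (H n)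
  refine eq_top_iff.2 fun f _ => ?_
  convert hpoly (Lagrange.interpolate Finset.univ id f) using 1
  ext x
  exact (Lagrange.eval_interpolate_at_node f (Function.injective_id.injOn)
    (Finset.mem_univ x)).symm

end PowerFunctions

theorem stmt_4 (F : Type) [Field F] [Fintype F] (q k t h : ℕ)
    (hq : Fintype.card F = q) (hk : 3 ≤ k) (ht : 1 ≤ t)
    (hth : t + h ≤ k - 1)
    (η : F) (hη : η ≠ 0)
    (h1 : q + 1 < 2 * k + t) (h2 : 2 * k ≤ q) :
    schurSq (stdCode F (twistedPolySet F k t h η)) = ⊤ := by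
  subst hq
  have low (s : ℕ) (hs : 2 ≤ s) (hs' : s ≤ 2 * k - 2) :
      (fun x : F => x ^ s) ∈ schurSq (stdCode F (twistedPolySet F k t h η)) := by
    obtain ⟨i, j, rfl, hi, hih, hj, hjh⟩ :
        ∃ i j, s = i + j ∧ i < k ∧ i ≠ h ∧ j < k ∧ j ≠ h := by
      by_cases hsk : s < k
      · by_cases hsh : h = 0 ∨ s = h
        · exact ⟨1, s - 1, by omega⟩
        · exact ⟨0, s, by omega⟩
      · by_cases hsh : s = h + (k - 1)
        · exact ⟨k - 2, s - (k - 2), by omega⟩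
        · exact ⟨k - 1, s - (k - 1), by omega⟩
    exact pow_add_mem_schurSq η hi hih hj hjh
  have high (i : ℕ) (hi : 2 ≤ i) (hik : i < k) :
      (fun x : F => x ^ (i + (k - 1 + t))) ∈ schurSq (stdCode F (twistedPolySet F k t h η)) := by
    by_cases hih : i = h
    · exact low _ (by omega) (by omega)
    · exact (pow_add_iff_mem_schurSq hη (by omega) hik hih).1 (low _ (by omega) (by omega))
  have one : (fun x : F => x ^ 1) ∈ schurSq (stdCode F (twistedPolySet F k t h η)) := by
    have hcard := high (Fintype.card F - (k - 1 + t)) (by omega) (by omega)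
    rw [Nat.sub_add_cancel (by omega)] at hcard
    simpa [FiniteField.pow_card] using hcard
  have pos := pow_mem_of_pow_mem_Icc
    (S := schurSq (stdCode F (twistedPolySet F k t h η))) fun s hs hsq => by
      rcases hs.eq_or_lt with rfl | hs
      · exact one
      by_cases hsk : s ≤ 2 * k - 2
      · exact low s hs hsk
      by_cases hsm : s = 1 + (k - 1 + t)
      · obtain rfl : h = 0 := by omega
        rw [hsm]
        exact (pow_add_iff_mem_schurSq hη (by omega) (by omega) one_ne_zero).1 one
      · have hs' := high (s - (k - 1 + t)) (by omega) (by omega)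
        rwa [Nat.sub_add_cancel (by omega)] at hs'
  refine eq_top_of_forall_pow_mem fun s => ?_
  rcases Nat.eq_zero_or_pos s with rfl | hs
  · by_cases hh : h = 0
    · subst hh
      exact pow_two_mul_mem_schurSq η (by omega) (pos _ (by omega)) (pos _ (by omega))
    · exact pow_add_mem_schurSq η (by omega) (Ne.symm hh) (by omega) (Ne.symm hh)
  · exact pos s hs
end
end

section
/- Let q be a prime power, k, t, h integers with k ≥ 3, t ≥ 1, h ≥ 0, t+h ≤ k−1, η ∈ 𝔽_q^*, and let n be an integer with 2k ≤ n ≤ q. Let α = (α_{i_1},…,α_{i_n}) be a vector of pairwise distinct elements of 𝔽_q and v = (v_1,…,v_n) ∈ (𝔽_q^*)^n. Define V_{k,t,h,η}^⊥ = { f ∈ 𝔽_q[x] : deg f ≤ q−1 and (f(α_1),…,f(α_q)) lies in the dual code of the Schur square of the standard TRS code C_{V_{k,t,h,η}} }. Then the GTRS code C_{V_{k,t,h,η}}(α,v) is self-orthogonal if and only if there exists f ∈ V_{k,t,h,η}^⊥ such that f(α_{i_j}) = v_j² for all j = 1,…,n and f(β) = 0 for every β ∈ 𝔽_q \ {α_{i_1},…,α_{i_n}}.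 -/
open Polynomial

noncomputable section

theorem mem_dualCode_schurSq_iff {F : Type} [Field F] {ι : Type} [Fintype ι] (C : Set (ι → F))
    (x : ι → F) :
    x ∈ dualCode (schurSq C : Set (ι → F)) ↔
      ∀ c₁ ∈ C, ∀ c₂ ∈ C, ∑ j, x j * (c₁ j * c₂ j) = 0 := by
  constructor
  · intro hx c₁ h₁ c₂ h₂
    exact hx _ (Submodule.subset_span ⟨c₁, h₁, c₂, h₂, rfl⟩)
  · intro hx c hc
    refine Submodule.span_induction (p := fun c _ => ∑ j, x j * c j = 0) ?_ ?_ ?_ ?_ hc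
    · rintro _ ⟨c₁, h₁, c₂, h₂, rfl⟩
      exact hx c₁ h₁ c₂ h₂
    · simp
    · intro a b _ _ ha hb
      simp [mul_add, Finset.sum_add_distrib, ha, hb]
    · intro r a _ ha
      simp [mul_left_comm _ r, ← Finset.mul_sum, ha]

/-- An evaluation code is self-orthogonal exactly when the squared multipliers, extended by zero
to all of `F`, lie in the dual of the Schur square of the standard code. -/
theorem selfOrthogonal_evalCode_iff {F : Type} [Field F] [Fintype F] {n : ℕ}
    (V : Set (Polynomial F)) {α : Fin n → F} (hα : Function.Injective α) (v : Fin n → F)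
    {g : F → F} (hg : ∀ j, g (α j) = v j ^ 2) (hg₀ : ∀ β, β ∉ Set.range α → g β = 0) :
    SelfOrthogonal (evalCode V α v) ↔ g ∈ dualCode (schurSq (stdCode F V) : Set (F → F)) := by
  have key (p r : Polynomial F) :
      ∑ j, v j * p.eval (α j) * (v j * r.eval (α j)) = ∑ x, g x * (p.eval x * r.eval x) := by
    refine Fintype.sum_of_injective α hα _ _ (fun x hx => by simp [hg₀ x hx]) fun j => ?_
    rw [hg]
    ring
  rw [mem_dualCode_schurSq_iff]
  constructor
  · rintro hS _ ⟨p, hp, rfl⟩ _ ⟨r, hr, rfl⟩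
    rw [← key]
    exact hS ⟨p, hp, rfl⟩ _ ⟨r, hr, rfl⟩
  · rintro hD _ ⟨p, hp, rfl⟩ _ ⟨r, hr, rfl⟩
    rw [key]
    exact hD _ ⟨p, hp, rfl⟩ _ ⟨r, hr, rfl⟩

theorem stmt_12 (F : Type) [Field F] [Fintype F] (q k t h n : ℕ)
    (hq : Fintype.card F = q) (hk : 3 ≤ k) (ht : 1 ≤ t)
    (hth : t + h ≤ k - 1)
    (η : F) (hη : η ≠ 0)
    (hn1 : 2 * k ≤ n) (hn2 : n ≤ q)
    (α : Fin n → F) (hα : Function.Injective α)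
    (v : Fin n → F) (hv : ∀ j, v j ≠ 0) :
    SelfOrthogonal (evalCode (twistedPolySet F k t h η) α v) ↔
      ∃ f : Polynomial F, f.degree < (q : ℕ) ∧
        (fun x : F => f.eval x) ∈
          dualCode ((schurSq (stdCode F (twistedPolySet F k t h η))) : Set (F → F)) ∧
        (∀ j, f.eval (α j) = v j ^ 2) ∧
        (∀ β : F, β ∉ Set.range α → f.eval β = 0) := by
  classical
  subst hq
  constructor
  · intro hS
    let g : F → F := Function.extend α (fun j => v j ^ 2) 0
    have hg (j) : g (α j) = v j ^ 2 := hα.extend_apply _ _ j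
    have hg₀ (β) (hβ : β ∉ Set.range α) : g β = 0 := Function.extend_apply' _ _ _ hβ
    have heval (x : F) : (Lagrange.interpolate Finset.univ id g).eval x = g x :=
      Lagrange.eval_interpolate_at_node g Function.injective_id.injOn (Finset.mem_univ x)
    refine ⟨Lagrange.interpolate Finset.univ id g,
      Lagrange.degree_interpolate_lt g Function.injective_id.injOn, ?_, ?_, ?_⟩
    · simpa only [heval] using (selfOrthogonal_evalCode_iff _ hα v hg hg₀).1 hS
    · simpa only [heval] using hg
    · simpa only [heval] using hg₀
  · rintro ⟨f, -, hf, hfα, hf₀⟩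
    exact (selfOrthogonal_evalCode_iff _ hα v hfα hf₀).2 hf
end
end

section
/- Let q be a prime power, k, t, h integers with k ≥ 3, t ≥ 1, h ≥ 0, t+h ≤ k−1, and suppose k > (q−t+1)/2. Then there is no self-orthogonal GTRS code of dimension k: for every η ∈ 𝔽_q^*, every n with k+t ≤ n ≤ q, every vector α = (α_{i_1},…,α_{i_n}) of pairwise distinct elements of 𝔽_q, and every v ∈ (𝔽_q^*)^n, the code C_{V_{k,t,h,η}}(α,v) is not self-orthogonal. -/
open Polynomial

noncomputable section

/-- Every `s ≤ 2k-2` is a sum of two elements of `{0, …, k-1} \ {h}`, up to a few exceptions. -/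
lemma exists_add_eq_of_ne {k h s : ℕ} (hk : 3 ≤ k) (hh : h + 2 ≤ k) (hs : s ≤ 2 * k - 2)
    (h0 : h = 0 → 2 ≤ s) (h1 : h = 1 → s ≠ 1) (h2 : h + 2 = k → s ≠ k - 1 + h) :
    ∃ i j, i < k ∧ j < k ∧ i ≠ h ∧ j ≠ h ∧ i + j = s := by
  by_cases hsk : s + 1 ≤ k
  · by_cases c : h = 0
    · exact ⟨1, s - 1, by omega, by omega, by omega, by omega, by omega⟩
    by_cases c' : s = h
    · exact ⟨1, s - 1, by omega, by omega, by omega, by omega, by omega⟩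
    · exact ⟨0, s, by omega, by omega, by omega, by omega, by omega⟩
  · by_cases c : s = k - 1 + h
    · exact ⟨k - 2, h + 1, by omega, by omega, by omega, by omega, by omega⟩
    · exact ⟨k - 1, s - (k - 1), by omega, by omega, by omega, by omega, by omega⟩

section TwistedMembership

variable {F : Type} [Field F] {k t h : ℕ} {η : F}

lemma X_pow_mem_twistedPolySet {i : ℕ} (hi : i < k) (hih : i ≠ h) :
    (X ^ i : F[X]) ∈ twistedPolySet F k t h η := by
  refine ⟨Pi.single i 1, ?_⟩
  rw [Finset.sum_eq_single_of_mem i (Finset.mem_range.2 hi)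
    (fun j _ hj => by simp [Pi.single_eq_of_ne hj])]
  simp [Pi.single_eq_of_ne hih.symm]

lemma twist_mem_twistedPolySet (hh : h < k) :
    (X ^ h + C η * X ^ (k - 1 + t) : F[X]) ∈ twistedPolySet F k t h η := by
  refine ⟨Pi.single h 1, ?_⟩
  rw [Finset.sum_eq_single_of_mem h (Finset.mem_range.2 hh)
    (fun j _ hj => by simp [Pi.single_eq_of_ne hj])]
  simp

end TwistedMembership

lemma SelfOrthogonal.sum_sq_mul_eval {F : Type} [Field F] {n : ℕ} {V : Set F[X]}
    {α v : Fin n → F} (H : SelfOrthogonal (evalCode V α v)) {f g : F[X]}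
    (hf : f ∈ V) (hg : g ∈ V) :
    ∑ j, v j ^ 2 * (f.eval (α j) * g.eval (α j)) = 0 := by
  have := H ⟨f, hf, rfl⟩ _ ⟨g, hg, rfl⟩
  rw [← this]
  exact Finset.sum_congr rfl fun j _ => by ring

/-- The Lagrange-type indicator `1 - (x - a)^(q-1)` extracts a single weight. -/
lemma sum_mul_one_sub_pow_card_sub_one {F : Type} [Field F] [Fintype F] {n : ℕ}
    {α : Fin n → F} (hα : Function.Injective α) (w : Fin n → F) (i : Fin n) :
    ∑ j, w j * (1 - (α j - α i) ^ (Fintype.card F - 1)) = w i := by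
  have hc : Fintype.card F - 1 ≠ 0 := by
    have := Fintype.one_lt_card (α := F)
    omega
  rw [Finset.sum_eq_single i]
  · simp [hc]
  · intro j _ hj
    rw [FiniteField.pow_card_sub_one_eq_one _ (sub_ne_zero.2 (hα.ne hj))]
    simp
  · simp

/-- The combinatorial part: apart from two exceptional parameter families, the relations satisfied
by the power moments `M` of a self-orthogonal twisted code force all of them to vanish. -/
lemma moments_eq_zero {F : Type} [Field F] {q k t h : ℕ} {η : F} {M : ℕ → F} (hη : η ≠ 0)
    (hk : 3 ≤ k) (ht : 1 ≤ t) (hth : t + h ≤ k - 1) (hkq : q + 1 < 2 * k + t) (hq : k + t ≤ q)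
    (hmono : ∀ i j, i < k → j < k → i ≠ h → j ≠ h → M (i + j) = 0)
    (htwist : ∀ i, i < k → i ≠ h → M (i + h) + η * M (i + (k - 1 + t)) = 0)
    (htwist' : M (h + h) + 2 * η * M (h + (k - 1 + t)) +
      η ^ 2 * M ((k - 1 + t) + (k - 1 + t)) = 0)
    (hper : ∀ s, M (s + q) = M (s + 1))
    (hA : ¬ (h = 0 ∧ q = 2 * k - 1 ∧ t = k - 1 ∧ η = -1))
    (hB : ¬ (h = 1 ∧ k = 3 ∧ q = 5)) :
    ∀ s, s < q → M s = 0 := by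
  have hbase : ∀ s, s ≤ 2 * k - 2 → (h = 0 → 2 ≤ s) → (h = 1 → s ≠ 1) →
      (h + 2 = k → s ≠ k - 1 + h) → M s = 0 := by
    intro s h1 h2 h3 h4
    obtain ⟨i, j, hi, hj, hih, hjh, rfl⟩ := exists_add_eq_of_ne hk (by omega) h1 h2 h3 h4
    exact hmono i j hi hj hih hjh
  have hup : ∀ i, i < k → i ≠ h → M (i + h) = 0 → M (i + (k - 1 + t)) = 0 := by
    intro i hi hih h0
    have := htwist i hi hih
    rw [h0, zero_add] at this
    exact (mul_eq_zero.1 this).resolve_left hη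
  have hdown : ∀ i, i < k → i ≠ h → M (i + (k - 1 + t)) = 0 → M (i + h) = 0 := by
    intro i hi hih h0
    simpa [h0] using htwist i hi hih
  rcases Nat.eq_zero_or_pos h with rfl | hpos
  · have h2 : ∀ s, 2 ≤ s → s ≤ 2 * k - 2 → M s = 0 := fun s a b =>
      hbase s b (by omega) (by omega) (by omega)
    have hhi : ∀ s, k + 1 + t ≤ s → s ≤ 2 * k - 2 + t → M s = 0 := by
      intro s a b
      have := hup (s - (k - 1 + t)) (by omega) (by omega) (h2 _ (by omega) (by omega))
      rwa [show s - (k - 1 + t) + (k - 1 + t) = s by omega] at this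
    have hM1 : M 1 = 0 := by
      by_cases c : t + 2 ≤ k
      · exact hdown 1 (by omega) (by omega) (h2 _ (by omega) (by omega))
      · have h1 := hper 0
        rw [zero_add, zero_add] at h1
        by_cases c' : q = 2 * k - 1
        · have h3 := htwist 1 (by omega) (by omega)
          rw [show 1 + (k - 1 + t) = q by omega, h1, add_zero] at h3
          have h4 : (1 + η) * M 1 = 0 := by linear_combination h3
          refine (mul_eq_zero.1 h4).resolve_left fun h5 => hA ⟨rfl, c', by omega, ?_⟩
          linear_combination h5
        · rw [← h1]
          exact hhi q (by omega) (by omega)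
    have hlow : ∀ s, 1 ≤ s → s ≤ 2 * k - 2 + t → M s = 0 := by
      intro s a b
      by_cases c : s = 1
      · rwa [c]
      by_cases c1 : s ≤ 2 * k - 2
      · exact h2 s (by omega) c1
      by_cases c2 : s = 1 + (k - 1 + t)
      · rw [c2]
        exact hup 1 (by omega) (by omega) hM1
      · exact hhi s (by omega) b
    have hall : ∀ s, 1 ≤ s → M s = 0 := by
      intro s
      induction s using Nat.strong_induction_on with
      | _ s ih =>
        intro hs
        by_cases c : s < q
        · exact hlow s hs (by omega)
        · have := hper (s - q)
          rw [show s - q + q = s by omega] at this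
          rw [this]
          exact ih _ (by omega) (by omega)
    intro s _
    by_cases c : s = 0
    · subst c
      rw [hall (0 + (k - 1 + t)) (by omega), hall (k - 1 + t + (k - 1 + t)) (by omega)] at htwist'
      simpa using htwist'
    · exact hall s (by omega)
  · have hM1 : M 1 = 0 := by
      by_cases c : h = 1
      · subst c
        by_cases c' : k = 3
        · subst c'
          have hq4 : q = 4 := by omega
          subst hq4
          have h1 := hper 0
          rw [zero_add, zero_add] at h1
          rw [← h1]
          exact hbase 4 (by omega) (by omega) (by omega) (by omega)
        · exact hdown 0 (by omega) (by omega)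
            (hbase _ (by omega) (by omega) (by omega) (by omega))
      · exact hbase 1 (by omega) (by omega) (by omega) (by omega)
    have hlow : ∀ s, s ≤ 2 * k - 2 → M s = 0 := by
      intro s hs
      by_cases c1 : s = 1
      · rwa [c1]
      by_cases c : h + 2 = k ∧ s = k - 1 + h
      · have := hup (k - 3) (by omega) (by omega) (by
          by_cases c3 : k = 3
          · rwa [show k - 3 + h = 1 by omega]
          · exact hbase _ (by omega) (by omega) (by omega) (by omega))
        rwa [show k - 3 + (k - 1 + t) = s by omega] at this
      · exact hbase s hs (by omega) (by omega) (by omega)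
    intro s hs
    by_cases c : s ≤ 2 * k - 2
    · exact hlow s c
    · have := hup (s - (k - 1 + t)) (by omega) (by omega) (hlow _ (by omega))
      rwa [show s - (k - 1 + t) + (k - 1 + t) = s by omega] at this

theorem stmt_13 (F : Type) [Field F] [Fintype F] (q k t h : ℕ)
    (hq : Fintype.card F = q) (hk : 3 ≤ k) (ht : 1 ≤ t)
    (hth : t + h ≤ k - 1)
    (hkq : q + 1 < 2 * k + t) :
    ∀ (η : F), η ≠ 0 → ∀ n : ℕ, k + t ≤ n → n ≤ q →
      ∀ α : Fin n → F, Function.Injective α →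
      ∀ v : Fin n → F, (∀ j, v j ≠ 0) →
        ¬ SelfOrthogonal (evalCode (twistedPolySet F k t h η) α v) := by
  intro η hη n hn hnq α hα v hv H
  obtain ⟨M, hM⟩ : ∃ M : ℕ → F, ∀ s, M s = ∑ j, v j ^ 2 * α j ^ s := ⟨_, fun _ => rfl⟩
  have hmono : ∀ i j, i < k → j < k → i ≠ h → j ≠ h → M (i + j) = 0 := by
    intro i j hi hj hih hjh
    have := H.sum_sq_mul_eval (X_pow_mem_twistedPolySet hi hih) (X_pow_mem_twistedPolySet hj hjh)
    rw [hM, ← this]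
    exact Finset.sum_congr rfl fun l _ => by simp [pow_add]
  have hhk : h < k := by omega
  have htwist : ∀ i, i < k → i ≠ h → M (i + h) + η * M (i + (k - 1 + t)) = 0 := by
    intro i hi hih
    have := H.sum_sq_mul_eval (X_pow_mem_twistedPolySet hi hih) (twist_mem_twistedPolySet hhk)
    rw [hM, hM, ← this, Finset.mul_sum, ← Finset.sum_add_distrib]
    refine Finset.sum_congr rfl fun l _ => ?_
    simp only [eval_pow, eval_X, eval_add, eval_mul, eval_C]
    ring
  have htwist' : M (h + h) + 2 * η * M (h + (k - 1 + t)) +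
      η ^ 2 * M ((k - 1 + t) + (k - 1 + t)) = 0 := by
    have := H.sum_sq_mul_eval (twist_mem_twistedPolySet hhk) (twist_mem_twistedPolySet hhk)
    rw [hM, hM, hM, ← this, Finset.mul_sum, Finset.mul_sum, ← Finset.sum_add_distrib,
      ← Finset.sum_add_distrib]
    refine Finset.sum_congr rfl fun l _ => ?_
    simp only [eval_pow, eval_X, eval_add, eval_mul, eval_C]
    ring
  have hper : ∀ s, M (s + q) = M (s + 1) := by
    intro s
    rw [hM, hM]
    refine Finset.sum_congr rfl fun l _ => ?_
    rw [pow_add, pow_add, ← hq, FiniteField.pow_card, pow_one]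
  by_cases hA : h = 0 ∧ q = 2 * k - 1 ∧ t = k - 1 ∧ η = -1
  · obtain ⟨rfl, hqk, htk, rfl⟩ := hA
    have hsurj : Function.Surjective α :=
      ((Fintype.bijective_iff_injective_and_card α).2 ⟨hα, by rw [Fintype.card_fin]; omega⟩).2
    obtain ⟨i, hi⟩ := hsurj 0
    have hw := sum_mul_one_sub_pow_card_sub_one hα (fun j => v j ^ 2) i
    have hlast : M (q - 1) = 0 := by
      rw [show q - 1 = (k - 1) + (k - 1) by omega]
      exact hmono _ _ (by omega) (by omega) (by omega) (by omega)
    have hdbl := hper (q - 2)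
    rw [show q - 2 + 1 = q - 1 by omega, hlast,
      show q - 2 + q = k - 1 + t + (k - 1 + t) by omega] at hdbl
    rw [show 0 + (k - 1 + t) = q - 1 by omega, hlast, hdbl] at htwist'
    have hM0 : M 0 = 0 := by simpa using htwist'
    have hdiff : M 0 - M (q - 1) = v i ^ 2 := by
      rw [← hw, hM, hM, ← Finset.sum_sub_distrib]
      refine Finset.sum_congr rfl fun l _ => ?_
      rw [hi, hq]
      ring
    rw [hM0, hlast, sub_zero] at hdiff
    exact pow_ne_zero 2 (hv i) hdiff.symm
  by_cases hB : h = 1 ∧ k = 3 ∧ q = 5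
  · obtain ⟨rfl, rfl, rfl⟩ := hB
    obtain rfl : t = 1 := by omega
    have h5 : (5 : F) = 0 := by
      have := Nat.cast_card_eq_zero F
      rw [hq] at this
      exact_mod_cast this
    have hM0 : M 0 = 0 := hmono 0 0 (by omega) (by omega) (by omega) (by omega)
    have hM2 : M 2 = 0 := hmono 0 2 (by omega) (by omega) (by omega) (by omega)
    have hM4 : M 4 = 0 := hmono 2 2 (by omega) (by omega) (by omega) (by omega)
    have e1 : M 1 + η * M 3 = 0 := htwist 0 (by omega) (by omega)
    have e2 : M 3 + η * M 5 = 0 := htwist 2 (by omega) (by omega)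
    have e3 : M 5 = M 1 := hper 0
    have hwt : ∀ i, v i ^ 2 = -(M 3 * α i * (1 - η * α i ^ 2)) := by
      intro i
      have hw := sum_mul_one_sub_pow_card_sub_one hα (fun j => v j ^ 2) i
      have : ∑ j, v j ^ 2 * (1 - (α j - α i) ^ (Fintype.card F - 1)) =
          M 0 - M 4 + 4 * α i * M 3 - 6 * α i ^ 2 * M 2 + 4 * α i ^ 3 * M 1 - α i ^ 4 * M 0 := by
        simp only [hM, Finset.mul_sum, ← Finset.sum_sub_distrib, ← Finset.sum_add_distrib, hq]
        exact Finset.sum_congr rfl fun l _ => by ring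
      rw [← hw, this, hM0, hM2, hM4]
      linear_combination 4 * α i ^ 3 * e1 + (α i * M 3 - α i ^ 3 * η * M 3) * h5
    have hne0 : ∀ i, α i ≠ 0 := fun i hi => pow_ne_zero 2 (hv i) (by rw [hwt, hi]; ring)
    have hmiss : ∃ b : F, b ≠ 0 ∧ ∀ i, α i ≠ b := by
      have hprod : M 3 * ((1 - η) * (1 + η)) = 0 := by
        linear_combination e2 - η * e3 - η * e1
      have h20 : (2 : F) ≠ 0 := fun h2 => one_ne_zero (α := F) (by linear_combination h5 - 2 * h2)
      rcases mul_eq_zero.1 hprod with h3 | h3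
      · exact ⟨1, one_ne_zero, fun i _ => pow_ne_zero 2 (hv i) (by rw [hwt, h3]; ring)⟩
      rcases mul_eq_zero.1 h3 with h3 | h3
      · exact ⟨1, one_ne_zero, fun i hi => pow_ne_zero 2 (hv i) (by
          rw [hwt, hi]; linear_combination -M 3 * h3)⟩
      · exact ⟨2, h20, fun i hi => pow_ne_zero 2 (hv i) (by
          rw [hwt, hi]; linear_combination 8 * M 3 * h3 - 2 * M 3 * h5)⟩
    obtain ⟨b, hb0, hb⟩ := hmiss
    classical
    have hcard : (Finset.univ.image α).card ≤ (({0, b} : Finset F)ᶜ).card := by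
      refine Finset.card_le_card fun x hx => ?_
      obtain ⟨i, -, rfl⟩ := Finset.mem_image.1 hx
      simp [hne0 i, hb i]
    rw [Finset.card_image_of_injective _ hα, Finset.card_compl, Finset.card_pair hb0.symm, hq,
      Finset.card_univ, Fintype.card_fin] at hcard
    omega
  have hall := moments_eq_zero hη hk ht hth hkq (hn.trans hnq) hmono htwist htwist' hper hA hB
  have hzero := Matrix.eq_zero_of_forall_pow_sum_mul_pow_eq_zero (v := fun j => v j ^ 2) hα
    (fun i => by rw [← hM]; exact hall i (by omega))
  exact pow_ne_zero 2 (hv ⟨0, by omega⟩) (congrFun hzero ⟨0, by omega⟩)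
end
end

section
/- Let q be a prime power, k, t, h integers with k ≥ 3, t ≥ 1, h ≥ 0, t+h ≤ k−1, (q−2t+1)/2 < k < (q−t+1)/2, and η ∈ 𝔽_q^*. Let l be a non-negative integer with l ≤ (q−2k−t)/2, set n = q−l, let α = (α_{i_1},…,α_{i_n}) be a vector of n pairwise distinct elements of 𝔽_q, and define v = (v_1,…,v_n) by v_j = Π_{β ∈ 𝔽_q \ {α_{i_1},…,α_{i_n}}} (α_{i_j} − β). Then each v_j is nonzero and the GTRS code C_{V_{k,t,h,η}}(α,v) is self-orthogonal. -/
open Polynomial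

noncomputable section

/-- The values of a polynomial of degree less than `q - 1` over `𝔽_q` sum to zero. -/
theorem sum_eval_eq_zero_of_natDegree_lt {F : Type} [Field F] [Fintype F] (p : F[X])
    (hp : p.natDegree < Fintype.card F - 1) : ∑ x : F, p.eval x = 0 := by
  simp only [Polynomial.eval_eq_sum_range]
  rw [Finset.sum_comm]
  refine Finset.sum_eq_zero fun i hi => ?_
  rw [← Finset.mul_sum, FiniteField.sum_pow_lt_card_sub_one, mul_zero]
  have := Finset.mem_range.mp hi
  omega

/-- On a finite field of `q` elements, an exponent `m ≥ q` may be reduced by `q - 1`. -/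
theorem pow_sub_card_sub_one {F : Type} [Field F] [Fintype F] (x : F) {m : ℕ}
    (hm : Fintype.card F ≤ m) : x ^ (m - (Fintype.card F - 1)) = x ^ m := by
  have hpos : 0 < Fintype.card F := Fintype.card_pos
  obtain ⟨r, rfl⟩ := Nat.exists_eq_add_of_le hm
  rw [show Fintype.card F + r - (Fintype.card F - 1) = 1 + r by omega, pow_add, pow_add,
    FiniteField.pow_card, pow_one]

theorem natDegree_sum_range_C_mul_X_pow_le {F : Type} [Field F] (a : ℕ → F) (k : ℕ) :
    (∑ i ∈ Finset.range k, C (a i) * X ^ i).natDegree ≤ k - 1 := by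
  refine natDegree_sum_le_of_forall_le _ _ fun i hi => ?_
  have := Finset.mem_range.mp hi
  exact (natDegree_C_mul_X_pow_le _ _).trans (by omega)

/-- The weighted sum of the values of a product of two polynomials, each of degree less than `k`
up to a twist by a multiple of `X ^ m`, vanishes when the degrees avoid multiples of `q - 1`. -/
theorem sum_sq_mul_twisted_eq_zero {F : Type} [Field F] [Fintype F] (P f g : F[X]) (c d : F)
    {l k m : ℕ} (hP : P.natDegree ≤ l) (hf : f.natDegree ≤ k) (hg : g.natDegree ≤ k)
    (hkm : k ≤ m) (hlow : Fintype.card F ≤ 2 * m)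
    (hmid : 2 * l + k + m < Fintype.card F - 1)
    (hhigh : 2 * l + 2 * m < 2 * (Fintype.card F - 1)) :
    ∑ x : F, P.eval x ^ 2 * ((f + C c * X ^ m).eval x * (g + C d * X ^ m).eval x) = 0 := by
  set e := 2 * m - (Fintype.card F - 1) with he
  have key : (P ^ 2 * (f * g + (C c * X ^ m * g + C d * X ^ m * f)
      + C (c * d) * X ^ e)).natDegree < Fintype.card F - 1 := by
    have hP2 : (P ^ 2).natDegree ≤ 2 * l := natDegree_pow_le_of_le 2 hP
    have hc := natDegree_C_mul_X_pow_le c m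
    have hd := natDegree_C_mul_X_pow_le d m
    have hfg : (f * g).natDegree ≤ k + m := natDegree_mul_le_of_le hf (hg.trans hkm)
    have hcg : (C c * X ^ m * g).natDegree ≤ m + k := natDegree_mul_le_of_le hc hg
    have hdf : (C d * X ^ m * f).natDegree ≤ m + k := natDegree_mul_le_of_le hd hf
    have hcd := natDegree_C_mul_X_pow_le (c * d) e
    have hsum := natDegree_add_le_of_le
      (natDegree_add_le_of_le hfg (natDegree_add_le_of_le hcg hdf)) hcd
    have := natDegree_mul_le_of_le hP2 hsum
    omega
  rw [← sum_eval_eq_zero_of_natDegree_lt _ key]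
  refine Finset.sum_congr rfl fun x _ => ?_
  simp only [eval_mul, eval_add, eval_pow, eval_C, eval_X]
  rw [he, pow_sub_card_sub_one x hlow]
  ring

theorem stmt_15 (F : Type) [Field F] [Fintype F] [DecidableEq F] (q k t h l n : ℕ)
    (hq : Fintype.card F = q) (hk : 3 ≤ k) (ht : 1 ≤ t)
    (hth : t + h ≤ k - 1)
    (h1 : q + 1 < 2 * k + 2 * t) (h2 : 2 * k + t < q + 1)
    (η : F) (hη : η ≠ 0)
    (hl : 2 * l + 2 * k + t ≤ q) (hn : n = q - l)
    (α : Fin n → F) (hα : Function.Injective α)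
    (v : Fin n → F)
    (hv : ∀ j, v j = ∏ β ∈ Finset.univ \ Finset.image α Finset.univ, (α j - β)) :
    (∀ j, v j ≠ 0) ∧ SelfOrthogonal (evalCode (twistedPolySet F k t h η) α v) := by
  have hinj : (Finset.univ.image α).card = n := by
    rw [Finset.card_image_of_injective _ hα, Finset.card_univ, Fintype.card_fin]
  set S : Finset F := Finset.univ \ Finset.univ.image α with hS
  have hScard : S.card ≤ l := by
    rw [hS, Finset.card_sdiff_of_subset (Finset.subset_univ _), hinj, Finset.card_univ]
    omega
  set P : F[X] := ∏ β ∈ S, (X - C β) with hPdef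
  have hPeval (x : F) : P.eval x = ∏ β ∈ S, (x - β) := by
    simp [hPdef, eval_prod]
  have hPdeg : P.natDegree ≤ l := by
    rw [hPdef, natDegree_finsetProd_X_sub_C_eq_card]
    exact hScard
  refine ⟨fun j => ?_, ?_⟩
  · rw [hv, Finset.prod_ne_zero_iff]
    intro β hβ h0
    rw [sub_eq_zero] at h0
    simp [hS, ← h0] at hβ
  · rintro _ ⟨_, ⟨a, rfl⟩, rfl⟩ _ ⟨_, ⟨b, rfl⟩, rfl⟩
    subst hq
    have hzero := sum_sq_mul_twisted_eq_zero P _ _ (η * a h) (η * b h) (m := k - 1 + t) hPdeg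
      (natDegree_sum_range_C_mul_X_pow_le a k) (natDegree_sum_range_C_mul_X_pow_le b k)
      (by omega) (by omega) (by omega) (by omega)
    rw [← Finset.sum_subset (Finset.subset_univ (Finset.univ.image α)),
      Finset.sum_image hα.injOn] at hzero
    · rw [← hzero]
      refine Finset.sum_congr rfl fun j _ => ?_
      beta_reduce
      rw [hv, hPeval]
      ring
    · intro x _ hx
      have hxS : x ∈ S := by simpa [hS] using hx
      rw [hPeval, Finset.prod_eq_zero hxS (sub_self x)]
      ring
end
end

section
/- Let p be a prime, r and m positive integers with 3 ≤ r and r | m, q = p^m and n = p^r. Let k, t, h be integers with k ≥ 3, t ≥ 1, h ≥ 0, t+h ≤ k−1, and η ∈ 𝔽_{p^m}^*. Let α = (α_{i_1},…,α_{i_n}) enumerate all elements of the subfield 𝔽_{p^r} ⊆ 𝔽_{p^m}, and let 1 denote the all-ones vector of length n. If one of the following holds: (1) t = 1 and 2k+t+2 = p^r; (2) t is odd, t ≥ 3, and 2k+t = p^r; (3) t = 2 and 2k+t+3 = p^r; (4) t is even, t ≥ 4, and 2k+t+1 = p^r; then the TRS code C_{V_{k,t,h,η}}(α,1) is self-orthogonal.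 -/
open Polynomial

noncomputable section

/-- The power sums of exponent below `card K - 1` vanish, and shifting the exponent by `card K - 1`
preserves this for positive exponents. -/
theorem sum_pow_eq_zero_of_lt_or_between {K : Type} [Field K] [Fintype K] {e : ℕ}
    (he : e < Fintype.card K - 1 ∨
      (Fintype.card K ≤ e ∧ e < 2 * (Fintype.card K - 1))) :
    ∑ x : K, x ^ e = 0 := by
  rcases he with he | ⟨h₁, h₂⟩
  · exact FiniteField.sum_pow_lt_card_sub_one K e he
  · obtain ⟨s, rfl⟩ := Nat.exists_eq_add_of_le h₁
    rw [← FiniteField.sum_pow_lt_card_sub_one K (s + 1) (by omega)]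
    refine Finset.sum_congr rfl fun x _ => ?_
    rw [pow_add, FiniteField.pow_card, pow_succ']

theorem sum_pow_enum_subfield {F : Type} [Field F] [Fintype F] {n : ℕ} (E : Subfield F)
    {α : Fin n → F} (hα : Function.Injective α) (hrange : Set.range α = (E : Set F)) {e : ℕ}
    (he : e < Nat.card E - 1 ∨ (Nat.card E ≤ e ∧ e < 2 * (Nat.card E - 1))) :
    ∑ j, α j ^ e = 0 := by
  classical
  have : Fintype E := Fintype.ofFinite E
  rw [Nat.card_eq_fintype_card] at he
  let ψ : Fin n ≃ E := (Equiv.ofInjective α hα).trans (Equiv.setCongr hrange)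
  have hψ : ∀ j, ((ψ j : E) : F) = α j := fun _ => rfl
  simp_rw [← hψ]
  rw [Equiv.sum_comp ψ fun x : E => (x : F) ^ e]
  simpa using congrArg E.subtype (sum_pow_eq_zero_of_lt_or_between he)

theorem sum_eval_eq_zero_of_natDegree_lt_s17 {F : Type} [Field F] {n N : ℕ} {α : Fin n → F}
    (hα : ∀ e < N, ∑ j, α j ^ e = 0) {P : F[X]} (hP : P.natDegree < N) :
    ∑ j, P.eval (α j) = 0 := by
  simp_rw [eval_eq_sum_range' hP]
  rw [Finset.sum_comm]
  refine Finset.sum_eq_zero fun e he => ?_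
  rw [← Finset.mul_sum, hα e (Finset.mem_range.mp he), mul_zero]

theorem natDegree_sum_C_mul_X_pow_le {F : Type} [Field F] (k : ℕ) (a : ℕ → F) :
    (∑ i ∈ Finset.range k, C (a i) * X ^ i : F[X]).natDegree ≤ k - 1 :=
  natDegree_sum_le_of_forall_le _ _ fun i hi =>
    (natDegree_C_mul_X_pow_le _ _).trans (by have := Finset.mem_range.mp hi; omega)


theorem stmt_17 (p r m : ℕ) (hp : p.Prime) (hr : 3 ≤ r) (hrm : r ∣ m) (hm : 0 < m)
    (F : Type) [Field F] [Fintype F] (hq : Fintype.card F = p ^ m)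
    (n k t h : ℕ) (hn : n = p ^ r)
    (hk : 3 ≤ k) (ht : 1 ≤ t) (hth : t + h ≤ k - 1)
    (η : F) (hη : η ≠ 0)
    (E : Subfield F) (hE : Nat.card E = p ^ r)
    (α : Fin n → F) (hα : Function.Injective α) (hrange : Set.range α = (E : Set F))
    (hcond :
      (t = 1 ∧ 2 * k + t + 2 = p ^ r) ∨
      (Odd t ∧ 3 ≤ t ∧ 2 * k + t = p ^ r) ∨
      (t = 2 ∧ 2 * k + t + 3 = p ^ r) ∨
      (Even t ∧ 4 ≤ t ∧ 2 * k + t + 1 = p ^ r)) :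
    SelfOrthogonal (evalCode (twistedPolySet F k t h η) α 1) := by
  have hsum : ∀ e, (e < p ^ r - 1 ∨ (p ^ r ≤ e ∧ e < 2 * (p ^ r - 1))) → ∑ j, α j ^ e = 0 :=
    fun e he => sum_pow_enum_subfield E hα hrange (by rwa [hE])
  rintro _ ⟨f, ⟨a, rfl⟩, rfl⟩ _ ⟨g, ⟨b, rfl⟩, rfl⟩
  have hA := natDegree_sum_C_mul_X_pow_le k a
  have hB := natDegree_sum_C_mul_X_pow_le k b
  set A : F[X] := ∑ i ∈ Finset.range k, C (a i) * X ^ i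
  set B : F[X] := ∑ i ∈ Finset.range k, C (b i) * X ^ i
  set N := k - 1 + t with hN
  have hu := natDegree_C_mul_X_pow_le (η * a h) N
  have hv := natDegree_C_mul_X_pow_le (η * b h) N
  set U : F[X] := C (η * a h) * X ^ N with hU
  set V : F[X] := C (η * b h) * X ^ N with hV
  have hlow : ∑ j, (A * B + A * V + U * B).eval (α j) = 0 := by
    refine sum_eval_eq_zero_of_natDegree_lt_s17 (fun e he => hsum e (Or.inl he)) ?_
    have h₁ : (A * B + A * V + U * B).natDegree ≤ k - 1 + N :=
      natDegree_add_le_of_degree_le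
        (natDegree_add_le_of_degree_le (natDegree_mul_le.trans (by omega))
          (natDegree_mul_le.trans (by omega)))
        (natDegree_mul_le.trans (by omega))
    omega
  have htop : ∑ j, (U * V).eval (α j) = 0 := by
    have hpow : ∑ j, α j ^ (N + N) = 0 := by
      apply hsum
      rcases hcond with h | ⟨-, h⟩ | h | ⟨-, h⟩ <;> omega
    calc ∑ j, (U * V).eval (α j)
        = ∑ j, η * a h * (η * b h) * α j ^ (N + N) := by
          refine Finset.sum_congr rfl fun j _ => ?_
          simp only [hU, hV, eval_mul, eval_C, eval_pow, eval_X]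
          ring
      _ = 0 := by rw [← Finset.mul_sum, hpow, mul_zero]
  rw [← add_zero (0 : F)]
  nth_rewrite 1 [← hlow]
  rw [← htop, ← Finset.sum_add_distrib]
  refine Finset.sum_congr rfl fun j _ => ?_
  simp only [Pi.one_apply, one_mul, eval_add, eval_mul]
  ring
end
end

section
/- Let r and m be positive integers with 3 ≤ r and r | m, q = 2^m and n = 2^r − 1. Let k, t, h be integers with k ≥ 3, t ≥ 1, h ≥ 0, t+h ≤ k−1, and η ∈ 𝔽_{2^m}^*. Let α = (α_{i_1},…,α_{i_n}) enumerate all nonzero elements of the subfield 𝔽_{2^r} ⊆ 𝔽_{2^m}, and define v = (v_1,…,v_n) by v_j = Π_{β ∈ 𝔽_{2^m} \ 𝔽_{2^r}^*} (α_{i_j} − β)^{2^{m−1}}. If one of the following holds: (1) t = 2 and 2k+t+3 = 2^r − 1; (2) t is even, t ≥ 4, and 2k+t+1 = 2^r − 1; (3) t = 1 and 2k+t+2 = 2^r − 1; (4) t is odd, t ≥ 3, and 2k+t = 2^r − 1; then each v_j is nonzero and the GTRS code C_{V_{k,t,h,η}}(α,v) is self-orthogonal. -/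
open Polynomial

noncomputable section

theorem prod_erase_sub_eq_neg_one {K : Type*} [Field K] [Fintype K] [DecidableEq K] (a : K) :
    ∏ b ∈ Finset.univ.erase a, (a - b) = -1 := by
  have hunits : ∏ u : Kˣ, (u : K) = -1 := by
    have := congrArg (Units.val) (FiniteField.prod_univ_units_id_eq_neg_one (K := K))
    simpa using this
  rw [← hunits]
  symm
  refine Finset.prod_bij (fun (u : Kˣ) _ => a - u) ?_ ?_ ?_ ?_
  · intro u _
    simp
  · intro u _ w _ huw
    exact Units.ext (sub_right_injective huw)
  · intro b hb
    have hab : a - b ≠ 0 := sub_ne_zero.2 (Finset.ne_of_mem_erase hb).symm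
    exact ⟨Units.mk0 _ hab, Finset.mem_univ _, by simp⟩
  · intro u _
    simp

/-- The product of `a - b` over all `b` outside the nonzero elements of a subfield is `a`,
for every nonzero `a` in the subfield. -/
theorem prod_sdiff_subfield_units_sub {F : Type*} [Field F] [Fintype F] [DecidableEq F]
    (E : Subfield F) (S : Finset F) (hS : (S : Set F) = (E : Set F) \ {0}) {a : F} (ha : a ∈ S) :
    ∏ b ∈ Finset.univ \ S, (a - b) = a := by
  classical
  have mem_S (x : F) : x ∈ S ↔ x ∈ E ∧ x ≠ 0 := by
    have := Set.ext_iff.1 hS x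
    simpa using this
  have haE : a ∈ E := ((mem_S a).1 ha).1
  have hE : ∏ b ∈ (insert 0 S).erase a, (a - b) = -1 := by
    have h := congrArg E.subtype (prod_erase_sub_eq_neg_one (⟨a, haE⟩ : E))
    rw [map_prod, map_neg, map_one] at h
    rw [← h]
    symm
    refine Finset.prod_bij (fun (u : E) _ => (u : F)) ?_ ?_ ?_ ?_
    · rintro ⟨u, hu⟩ hne
      have : u ≠ a := by simpa using hne
      simp only [Finset.mem_erase, Finset.mem_insert, mem_S]
      tauto
    · intro u _ w _ huw
      exact Subtype.ext huw
    · intro b hb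
      simp only [Finset.mem_erase, Finset.mem_insert, mem_S] at hb
      have hbE : b ∈ E := by
        rcases hb.2 with rfl | hb
        · exact E.zero_mem
        · exact hb.1
      exact ⟨⟨b, hbE⟩, by simpa using hb.1, rfl⟩
    · intro u _
      simp
  have h0 : (0 : F) ∉ S := by simp [mem_S]
  have hsplit : Finset.univ.erase a = (Finset.univ \ insert 0 S) ∪ (insert 0 S).erase a := by
    ext x
    by_cases hx : x = a <;> simp [hx, ha]
    tauto
  have hdisj : Disjoint (Finset.univ \ insert 0 S) ((insert 0 S).erase a) :=
    Finset.sdiff_disjoint.mono_right (Finset.erase_subset _ _)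
  have hout : ∏ b ∈ Finset.univ \ insert 0 S, (a - b) = 1 := by
    have h := prod_erase_sub_eq_neg_one a
    rw [hsplit, Finset.prod_union hdisj, hE] at h
    simpa using h
  have hins : Finset.univ \ S = insert 0 (Finset.univ \ insert 0 S) := by
    ext x
    by_cases hx : x = 0 <;> simp [hx, h0]
  rw [hins, Finset.prod_insert (by simp), hout]
  simp

theorem sum_pow_enum_subfield_units_eq_zero {F : Type*} [Field F] [Finite F] (E : Subfield F)
    {n : ℕ} (hE : Nat.card E = n + 1) (α : Fin n → F) (hα : Function.Injective α)
    (hrange : Set.range α = (E : Set F) \ {0}) {e : ℕ} (he : ¬ n ∣ e) :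
    ∑ j, α j ^ e = 0 := by
  classical
  have := Fintype.ofFinite E
  have hmem (j : Fin n) : α j ∈ E ∧ α j ≠ 0 := by
    have : α j ∈ (E : Set F) \ {0} := hrange ▸ Set.mem_range_self j
    simpa using this
  have h := FiniteField.sum_pow_units E e
  rw [← Nat.card_eq_fintype_card, hE, Nat.add_sub_cancel, if_neg he] at h
  have h' := congrArg E.subtype h
  rw [map_sum, map_zero] at h'
  rw [← h']
  refine Finset.sum_bij (fun j _ => Units.mk0 (⟨α j, (hmem j).1⟩ : E)
    (fun h0 => (hmem j).2 (congrArg Subtype.val h0))) ?_ ?_ ?_ ?_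
  · intro j _
    exact Finset.mem_univ _
  · intro i _ j _ hij
    exact hα (congrArg (fun u : Eˣ => ((u : E) : F)) hij)
  · intro u _
    have hu : ((u : E) : F) ∈ Set.range α := by
      rw [hrange]
      exact ⟨(u : E).2, by simp⟩
    obtain ⟨j, hj⟩ := hu
    exact ⟨j, Finset.mem_univ _, Units.ext (Subtype.ext hj)⟩
  · intro j _
    simp

/-- Evaluation vectors of polynomials with exponents in `S`, weighted by square roots of the
evaluation points, are orthogonal if the power sums of exponents `i + l + 1` vanish. -/
theorem sum_weighted_mul_eq_zero {F ι : Type*} [CommRing F] [Fintype ι] (α v : ι → F)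
    (hv : ∀ j, v j ^ 2 = α j) (S : Finset ℕ)
    (hS : ∀ i ∈ S, ∀ l ∈ S, ∑ j, α j ^ (i + l + 1) = 0) (a b : ℕ → F) :
    ∑ j, (v j * ∑ i ∈ S, a i * α j ^ i) * (v j * ∑ l ∈ S, b l * α j ^ l) = 0 := by
  have hterm (j : ι) : (v j * ∑ i ∈ S, a i * α j ^ i) * (v j * ∑ l ∈ S, b l * α j ^ l) =
      ∑ i ∈ S, ∑ l ∈ S, a i * b l * α j ^ (i + l + 1) := by
    rw [mul_mul_mul_comm, ← sq, hv, Finset.sum_mul_sum, Finset.mul_sum]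
    refine Finset.sum_congr rfl fun i _ => ?_
    rw [Finset.mul_sum]
    refine Finset.sum_congr rfl fun l _ => ?_
    ring
  simp_rw [hterm]
  rw [Finset.sum_comm]
  refine Finset.sum_eq_zero fun i hi => ?_
  rw [Finset.sum_comm]
  refine Finset.sum_eq_zero fun l hl => ?_
  rw [← Finset.mul_sum, hS i hi l hl, mul_zero]

theorem exists_eval_eq_sum_of_mem_twistedPolySet {F : Type} [Field F] {k t h : ℕ} {η : F}
    (ht : 1 ≤ t) {f : F[X]} (hf : f ∈ twistedPolySet F k t h η) :
    ∃ c : ℕ → F, ∀ x, f.eval x = ∑ i ∈ insert (k - 1 + t) (Finset.range k), c i * x ^ i := by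
  obtain ⟨a, rfl⟩ := hf
  refine ⟨fun i => if i < k then a i else η * a h, fun x => ?_⟩
  have hk : ¬ k - 1 + t < k := by omega
  rw [Finset.sum_insert (by simpa using hk), add_comm]
  beta_reduce
  rw [if_neg hk]
  simp only [eval_add, eval_finsetSum, eval_mul, eval_C, eval_pow, eval_X]
  congr 1
  refine Finset.sum_congr rfl fun i hi => ?_
  rw [if_pos (Finset.mem_range.1 hi)]

theorem stmt_18 (r m : ℕ) (hr : 3 ≤ r) (hrm : r ∣ m)
    (F : Type) [Field F] [Fintype F] [DecidableEq F] (hq : Fintype.card F = 2 ^ m)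
    (n k t h : ℕ) (hn : n = 2 ^ r - 1)
    (hk : 3 ≤ k) (ht : 1 ≤ t) (hth : t + h ≤ k - 1)
    (η : F) (hη : η ≠ 0)
    (E : Subfield F) (hE : Nat.card E = 2 ^ r)
    (α : Fin n → F) (hα : Function.Injective α)
    (hrange : Set.range α = (E : Set F) \ {0})
    (v : Fin n → F)
    (hv : ∀ j, v j =
      ∏ β ∈ Finset.univ \ Finset.image α Finset.univ, (α j - β) ^ 2 ^ (m - 1))
    (hcond :
      (t = 2 ∧ 2 * k + t + 3 = 2 ^ r - 1) ∨
      (Even t ∧ 4 ≤ t ∧ 2 * k + t + 1 = 2 ^ r - 1) ∨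
      (t = 1 ∧ 2 * k + t + 2 = 2 ^ r - 1) ∨
      (Odd t ∧ 3 ≤ t ∧ 2 * k + t = 2 ^ r - 1)) :
    (∀ j, v j ≠ 0) ∧ SelfOrthogonal (evalCode (twistedPolySet F k t h η) α v) := by
  have hm : m ≠ 0 := by
    rintro rfl
    have := Fintype.one_lt_card (α := F)
    omega
  have hpow : 2 ^ (m - 1) * 2 = Fintype.card F := by
    rw [hq, ← pow_succ, Nat.sub_add_cancel (Nat.pos_of_ne_zero hm)]
  have himage : ((Finset.image α Finset.univ : Finset F) : Set F) = (E : Set F) \ {0} := by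
    simpa using hrange
  have hvsq (j : Fin n) : v j ^ 2 = α j := by
    rw [hv, Finset.prod_pow, ← pow_mul, hpow, FiniteField.pow_card]
    exact prod_sdiff_subfield_units_sub E _ himage
      (Finset.mem_image_of_mem α (Finset.mem_univ j))
  have hα0 (j : Fin n) : α j ≠ 0 := by
    have : α j ∈ (E : Set F) \ {0} := hrange ▸ Set.mem_range_self j
    exact this.2
  refine ⟨fun j hj => hα0 j (by rw [← hvsq, hj]; simp), ?_⟩
  have hcard : Nat.card E = n + 1 := by
    have := Nat.one_le_two_pow (n := r)
    omega
  rintro _ ⟨f, hf, rfl⟩ _ ⟨g, hg, rfl⟩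
  obtain ⟨a, ha⟩ := exists_eval_eq_sum_of_mem_twistedPolySet ht hf
  obtain ⟨b, hb⟩ := exists_eval_eq_sum_of_mem_twistedPolySet ht hg
  simp_rw [ha, hb]
  refine sum_weighted_mul_eq_zero α v hvsq _ (fun i hi l hl => ?_) a b
  refine sum_pow_enum_subfield_units_eq_zero E hcard α hα hrange ?_
  have hexp : 0 < i + l + 1 ∧ i + l + 1 < n ∨ n < i + l + 1 ∧ i + l + 1 < 2 * n := by
    simp only [Finset.mem_insert, Finset.mem_range] at hi hl
    rw [← hn] at hcond
    omega
  rintro ⟨c, hc⟩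
  rw [hc] at hexp
  rcases hexp with ⟨h1, h2⟩ | ⟨h1, h2⟩
  · have : c < 1 := by nlinarith
    simp_all
  · have : 1 < c := by nlinarith
    nlinarith
end
end

section
/- Let p be a prime, r and m positive integers with 3 ≤ r, r | m and r < m, q = p^m and n = p^r. Let k, t, h be integers with k ≥ 3, t ≥ 1, h ≥ 0, t+h ≤ k−1, let η ∈ 𝔽_{p^m} \ 𝔽_{p^r} (in particular η ≠ 0), let α = (α_{i_1},…,α_{i_n}) enumerate all elements of the subfield 𝔽_{p^r} ⊆ 𝔽_{p^m}, and let 1 denote the all-ones vector of length n. Suppose one of the following holds: (1) t = 1 and 2k+t+2 = p^r; (2) t is odd, t ≥ 3, and 2k+t = p^r; (3) t = 2 and 2k+t+3 = p^r; (4) t is even, t ≥ 4, and 2k+t+1 = p^r. Then the code C_{V_{k,t,h,η}}(α,1) is a self-orthogonal MDS code (it has dimension k and minimum Hamming distance n−k+1), and it is not a generalized Reed–Solomon code, i.e., it is not equal to C_{V_k}(β,w) for any vector β of n pairwise distinct elements of 𝔽_q and any w ∈ (𝔽_q^*)^n, where V_k = { f ∈ 𝔽_q[x] : deg f ≤ k−1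 }. -/
open Polynomial

noncomputable section

section Evaluation

variable {F : Type*} [Field F]

/-- Evaluation of polynomials at the points of a finite family, with column multipliers. -/
def evalLM {n : ℕ} (α v : Fin n → F) : F[X] →ₗ[F] (Fin n → F) :=
  LinearMap.pi fun j => v j • Polynomial.leval (α j)

@[simp]
lemma evalLM_apply {n : ℕ} (α v : Fin n → F) (f : F[X]) (j : Fin n) :
    evalLM α v f j = v j * f.eval (α j) := by
  simp [evalLM]

/-- The linear map `f ↦ f + η f_h x^N`. -/
def twist (h N : ℕ) (η : F) : F[X] →ₗ[F] F[X] :=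
  LinearMap.id + (LinearMap.toSpanSingleton F F[X] (C η * X ^ N)).comp (Polynomial.lcoeff F h)

lemma twist_apply (h N : ℕ) (η : F) (f : F[X]) :
    twist h N η f = f + C (η * f.coeff h) * X ^ N := by
  simp [twist, smul_eq_C_mul]
  ring

lemma finrank_degreeLT (k : ℕ) : Module.finrank F (degreeLT F k) = k := by
  simpa using (degreeLTEquiv F k).finrank_eq

instance finite_degreeLT (k : ℕ) : Module.Finite F (degreeLT F k) :=
  Module.Finite.equiv (degreeLTEquiv F k).symm

/-- Polynomials of pairwise distinct degrees below `n` whose evaluations at `n` points lie in a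
subspace bound its dimension from below. -/
lemma card_le_finrank_of_degree_eq {n : ℕ} {α : Fin n → F} (hα : Function.Injective α)
    (S : Submodule F (Fin n → F)) (D : Finset ℕ) (hD : ∀ d ∈ D, d < n)
    (hP : ∀ d ∈ D, ∃ P : F[X], P.degree = d ∧ evalLM α 1 P ∈ S) :
    D.card ≤ Module.finrank F S := by
  classical
  choose! P hdeg hS using hP
  let Q : Polynomial.Sequence F :=
    { elems' := fun d => if d ∈ D then P d else X ^ d
      degree_eq' := fun d => by
        split_ifs with hd
        · exact hdeg d hd
        · simp }
  have hQ (d : D) : Q d = P d := by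
    change (if (d : ℕ) ∈ D then P d else X ^ (d : ℕ)) = P d
    simp
  have hli : LinearIndependent F fun d : D => Q d :=
    Q.linearIndependent.comp _ Subtype.val_injective
  have hspan : Submodule.span F (Set.range fun d : D => Q d) ≤ degreeLT F n := by
    rw [Submodule.span_le]
    rintro _ ⟨d, rfl⟩
    rw [SetLike.mem_coe, mem_degreeLT, Q.degree_eq]
    exact_mod_cast hD d d.2
  have hdisj : Disjoint (Submodule.span F (Set.range fun d : D => Q d))
      (LinearMap.ker (evalLM α 1)) := by
    rw [Submodule.disjoint_def]
    intro f hf hf0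
    refine eq_zero_of_degree_lt_of_eval_index_eq_zero Finset.univ (v := α) hα.injOn ?_ ?_
    · simpa using mem_degreeLT.1 (hspan hf)
    · intro j _
      simpa using congrFun (LinearMap.mem_ker.1 hf0) j
  have hli' := hli.map hdisj
  have hcard := finrank_span_eq_card hli'
  rw [Fintype.card_coe] at hcard
  rw [← hcard]
  refine Submodule.finrank_mono (Submodule.span_le.2 ?_)
  rintro _ ⟨d, rfl⟩
  simp only [Function.comp_apply, hQ]
  exact hS d d.2

/-- A twisted polynomial with `η` outside the subfield `E` has fewer than `k` zeros in `E`. -/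
lemma eq_zero_of_twist_eval_eq_zero {ι : Type*} (E : Subfield F) {η : F} (hη : η ∉ E)
    {h N k : ℕ} {α : ι → F} (hα : Function.Injective α) (hE : ∀ j, α j ∈ E)
    {f : F[X]} (hf : f.degree < k) (s : Finset ι) (hs : k ≤ s.card)
    (hev : ∀ j ∈ s, (twist h N η f).eval (α j) = 0) : f = 0 := by
  classical
  obtain ⟨s', hs', rfl⟩ := Finset.exists_subset_card_eq hs
  replace hev : ∀ j ∈ s', (twist h N η f).eval (α j) = 0 := fun j hj => hev j (hs' hj)
  simp only [twist_apply, eval_add, eval_mul, eval_C, eval_pow, eval_X] at hev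
  let αE : ι → E := fun j => ⟨α j, hE j⟩
  have hαE : Set.InjOn αE s' := fun i _ j _ hij => hα (congrArg Subtype.val hij)
  let R : E[X] := Lagrange.interpolate s' αE fun j => αE j ^ N
  have hR (j) (hj : j ∈ s') : (R.map E.subtype).eval (α j) = α j ^ N := by
    have h1 : α j = E.subtype (αE j) := rfl
    rw [h1, eval_map_apply, Lagrange.eval_interpolate_at_node _ hαE hj, map_pow]
  have hz : f + C (η * f.coeff h) * R.map E.subtype = 0 := by
    refine eq_zero_of_degree_lt_of_eval_index_eq_zero s' (v := α) hα.injOn ?_ ?_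
    · refine (degree_add_le _ _).trans_lt (max_lt hf ?_)
      rw [← smul_eq_C_mul]
      refine (degree_smul_le _ _).trans_lt ?_
      exact degree_map_le.trans_lt (Lagrange.degree_interpolate_lt _ hαE)
    · intro j hj
      simpa [hR j hj] using hev j hj
  have hc : f.coeff h * (1 + η * (R.coeff h : F)) = 0 := by
    have := congrArg (fun g => g.coeff h) hz
    simp only [coeff_add, coeff_C_mul, coeff_map, coeff_zero, Subfield.subtype_apply] at this
    linear_combination this
  rcases mul_eq_zero.1 hc with hc | hc
  · simpa [hc] using hz
  · refine absurd ?_ hη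
    have hne : (R.coeff h : F) ≠ 0 := by
      intro h0
      simp [h0] at hc
    have : η = -(R.coeff h : F)⁻¹ := by
      field_simp
      linear_combination hc
    rw [this]
    exact E.neg_mem (E.inv_mem (R.coeff h).2)

lemma sum_pow_eq_zero {K : Type*} [Field K] [Fintype K] {i : ℕ}
    (h1 : i ≠ Fintype.card K - 1) (h2 : i < 2 * (Fintype.card K - 1)) :
    ∑ x : K, x ^ i = 0 := by
  rcases lt_or_gt_of_ne h1 with h | h
  · exact FiniteField.sum_pow_lt_card_sub_one _ _ h
  · have hi (x : K) : x ^ i = x ^ (i - Fintype.card K + 1) := by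
      conv_lhs => rw [show i = (i - Fintype.card K) + Fintype.card K by omega, pow_add,
        FiniteField.pow_card, ← pow_succ]
    simp only [hi]
    exact FiniteField.sum_pow_lt_card_sub_one _ _ (by omega)

lemma sum_subfield_pow_eq_zero {ι : Type*} [Fintype ι] (E : Subfield F) [Fintype E]
    {α : ι → F} (hα : Function.Injective α) (hrange : Set.range α = E) {i : ℕ}
    (h1 : i ≠ Fintype.card E - 1) (h2 : i < 2 * (Fintype.card E - 1)) :
    ∑ j, α j ^ i = 0 := by
  let e : ι ≃ E := Equiv.ofBijective (fun j => ⟨α j, hrange.subset (Set.mem_range_self j)⟩)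
    ⟨fun a b hab => hα (congrArg Subtype.val hab), fun x => by
      obtain ⟨j, hj⟩ : (x : F) ∈ Set.range α := hrange.superset x.2
      exact ⟨j, Subtype.ext hj⟩⟩
  calc ∑ j, α j ^ i = ∑ x : E, (x : F) ^ i := e.sum_comp fun x : E => (x : F) ^ i
    _ = ((∑ x : E, x ^ i : E) : F) := by simp
    _ = 0 := by rw [sum_pow_eq_zero h1 h2]; simp

lemma sum_eval_eq_zero {ι : Type*} [Fintype ι] (E : Subfield F) [Fintype E]
    {α : ι → F} (hα : Function.Injective α) (hrange : Set.range α = E) {f : F[X]}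
    (hf : f.natDegree < Fintype.card E - 1) : ∑ j, f.eval (α j) = 0 := by
  simp only [eval_eq_sum_range]
  rw [Finset.sum_comm]
  refine Finset.sum_eq_zero fun i hi => ?_
  rw [← Finset.mul_sum, sum_subfield_pow_eq_zero E hα hrange, mul_zero] <;>
  · rw [Finset.mem_range] at hi
    omega

lemma sum_twist_mul_twist {ι : Type*} [Fintype ι] (E : Subfield F) [Fintype E]
    {α : ι → F} (hα : Function.Injective α) (hrange : Set.range α = E) {f g : F[X]}
    {k N h : ℕ} {η : F} (hk : 1 ≤ k) (hf : f.degree < k) (hg : g.degree < k)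
    (h1 : k - 1 + (k - 1) < Fintype.card E - 1) (h2 : k - 1 + N < Fintype.card E - 1)
    (h3 : N + N ≠ Fintype.card E - 1) :
    ∑ j, (twist h N η f).eval (α j) * (twist h N η g).eval (α j) = 0 := by
  have hnat {u : F[X]} (hu : u.degree < k) : u.natDegree ≤ k - 1 :=
    natDegree_le_of_degree_le (degree_le_of_natDegree_le (by
      by_cases h0 : u = 0
      · simp [h0]
      · have := (natDegree_lt_iff_degree_lt h0).2 hu
        omega))
  set a := η * f.coeff h with ha
  set b := η * g.coeff h with hb
  have key (j) : (twist h N η f).eval (α j) * (twist h N η g).eval (α j) =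
      (f * g).eval (α j) + ((C a * g + C b * f) * X ^ N).eval (α j)
        + a * b * α j ^ (N + N) := by
    simp only [twist_apply, ← ha, ← hb, eval_add, eval_mul, eval_C, eval_pow, eval_X]
    ring
  simp only [key, Finset.sum_add_distrib, ← Finset.mul_sum]
  rw [sum_eval_eq_zero E hα hrange, sum_eval_eq_zero E hα hrange,
    sum_subfield_pow_eq_zero E hα hrange h3 (by omega)]
  · simp
  · refine natDegree_mul_le.trans_lt ((add_le_add ?_ (natDegree_X_pow_le N)).trans_lt h2)
    refine natDegree_add_le_of_degree_le ?_ ?_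
    · exact (natDegree_C_mul_le _ _).trans (hnat hg)
    · exact (natDegree_C_mul_le _ _).trans (hnat hf)
  · exact lt_of_le_of_lt natDegree_mul_le (lt_of_le_of_lt (add_le_add (hnat hf) (hnat hg)) h1)

lemma degree_X_pow_add_C_mul_X_pow {η : F} (hη : η ≠ 0) {a b : ℕ} (hab : a < b) :
    (X ^ a + C η * X ^ b : F[X]).degree = b := by
  rw [degree_add_eq_right_of_degree_lt] <;> simp [hη, hab]

/-- Products of twisted polynomials attain at least `2 * k` degrees below `n`. -/
lemma exists_card_degrees_of_twist_mul_mem {k t h n : ℕ} {η : F} (hη : η ≠ 0)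
    (ht : 1 ≤ t) (hth : t + h ≤ k - 1) (hk : 3 ≤ k) (hn : 2 * k + t ≤ n + 1)
    (hn' : t ≤ 2 → 2 * k + 2 * t ≤ n + 1) (W : Submodule F F[X])
    (hW : ∀ f g : F[X], f.degree < k → g.degree < k →
      twist h (k - 1 + t) η f * twist h (k - 1 + t) η g ∈ W) :
    ∃ D : Finset ℕ, 2 * k ≤ D.card ∧ ∀ d ∈ D, d < n ∧ ∃ P : F[X], P.degree = d ∧ P ∈ W := by
  have hdeg {i : ℕ} (hi : i < k) : (X ^ i : F[X]).degree < k := by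
    rw [degree_X_pow]
    exact_mod_cast hi
  have htw {i : ℕ} (hi : i ≠ h) : twist h (k - 1 + t) η (X ^ i) = X ^ i := by
    simp [twist_apply, coeff_X_pow, hi.symm]
  have htwh : twist h (k - 1 + t) η (X ^ h) = X ^ h + C η * X ^ (k - 1 + t) := by
    simp [twist_apply]
  have memMono {i j : ℕ} (hi : i < k) (hih : i ≠ h) (hj : j < k) (hjh : j ≠ h) :
      (X ^ (i + j) : F[X]) ∈ W := by
    have := hW _ _ (hdeg hi) (hdeg hj)
    rwa [htw hih, htw hjh, ← pow_add] at this
  have memTwist {i : ℕ} (hi : i < k) (hih : i ≠ h) :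
      (X ^ (i + h) + C η * X ^ (i + (k - 1 + t)) : F[X]) ∈ W := by
    have := hW _ _ (hdeg hi) (hdeg (show h < k by omega))
    rw [htw hih, htwh] at this
    convert this using 1
    ring
  let G : ℕ → Prop := fun d => ∃ P : F[X], P.degree = d ∧ P ∈ W
  have gMono {s : ℕ} (i j : ℕ) (hi : i < k) (hih : i ≠ h) (hj : j < k) (hjh : j ≠ h)
      (hs : s = i + j) : G s :=
    ⟨X ^ (i + j), by simp [hs], memMono hi hih hj hjh⟩
  have gTwist {s : ℕ} (i : ℕ) (hi : i < k) (hih : i ≠ h) (hs : s = i + (k - 1 + t)) : G s :=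
    ⟨_, hs ▸ degree_X_pow_add_C_mul_X_pow hη (by omega), memTwist hi hih⟩
  have gSq : G (2 * (k - 1 + t)) := by
    refine ⟨_, ?_, hW _ _ (hdeg (show h < k by omega)) (hdeg (show h < k by omega))⟩
    rw [htwh, degree_mul, degree_X_pow_add_C_mul_X_pow hη (by omega), two_mul]
    simp
  have gHigh {s : ℕ} (h1 : 2 * k - 1 ≤ s) (h2 : s ≤ 2 * k - 2 + t) : G s :=
    gTwist (s - (k - 1 + t)) (by omega) (by omega) (by omega)
  have gPos (hh : 1 ≤ h) {s : ℕ} (h2 : s ≤ 2 * k - 2 + t) (h1 : s = 1 → h ≠ 1) : G s := by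
    rcases lt_or_ge s k with hs | hs
    · by_cases hsh : s = h
      · exact gMono 1 (h - 1) (by omega) (by omega) (by omega) (by omega) (by omega)
      · exact gMono 0 s (by omega) (by omega) (by omega) (by omega) (by omega)
    rcases le_or_gt (2 * k - 1) s with hs' | hs'
    · exact gHigh hs' h2
    by_cases hsh : s = h + (k - 1)
    · by_cases hhk : h = k - 2
      · exact gTwist (k - 3) (by omega) (by omega) (by omega)
      · exact gMono (k - 2) (h + 1) (by omega) (by omega) (by omega) (by omega) (by omega)
    · exact gMono (k - 1) (s - (k - 1)) (by omega) (by omega) (by omega) (by omega) (by omega)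
  have gZero (hh : h = 0) {s : ℕ} (h1 : 2 ≤ s) (h2 : s ≤ 2 * k - 2 + t) : G s := by
    rcases le_or_gt (2 * k - 1) s with hs' | hs'
    · exact gHigh hs' h2
    rcases lt_or_ge s k with hs | hs
    · exact gMono 1 (s - 1) (by omega) (by omega) (by omega) (by omega) (by omega)
    · exact gMono (k - 1) (s - (k - 1)) (by omega) (by omega) (by omega) (by omega) (by omega)
  have gOne (hh : h = 0) (ht1 : t = 1) : G 1 := by
    refine ⟨X ^ 1, by simp, ?_⟩
    have h1 := memTwist (i := 1) (by omega) (by omega)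
    have h2 := W.smul_mem η (memMono (i := k - 1) (j := 2) (by omega) (by omega) (by omega)
      (by omega))
    rw [smul_eq_C_mul, show k - 1 + 2 = 1 + (k - 1 + t) by omega] at h2
    simpa [hh] using W.sub_mem h1 h2
  rcases Nat.eq_zero_or_pos h with hh | hh
  · obtain ht1 | ht2 | ht3 : t = 1 ∨ t = 2 ∨ 3 ≤ t := by omega
    · refine ⟨Finset.Ico 1 (2 * k + 1), by simp, fun d hd => ?_⟩
      rw [Finset.mem_Ico] at hd
      refine ⟨by omega, ?_⟩
      rcases eq_or_ne d 1 with rfl | hd1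
      · exact gOne hh ht1
      rcases eq_or_ne d (2 * (k - 1 + t)) with rfl | hd2
      · exact gSq
      · exact gZero hh (by omega) (by omega)
    · refine ⟨insert (2 * (k - 1 + t)) (Finset.Ico 2 (2 * k + 1)), ?_, fun d hd => ?_⟩
      · rw [Finset.card_insert_of_notMem (by rw [Finset.mem_Ico]; omega), Nat.card_Ico]
        omega
      rw [Finset.mem_insert, Finset.mem_Ico] at hd
      refine ⟨by omega, ?_⟩
      rcases hd with rfl | hd
      · exact gSq
      · exact gZero hh (by omega) (by omega)
    · refine ⟨Finset.Ico 2 (2 * k + 2), by simp, fun d hd => ?_⟩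
      rw [Finset.mem_Ico] at hd
      exact ⟨by omega, gZero hh (by omega) (by omega)⟩
  · refine ⟨(Finset.range (2 * k + 1)).erase 1, ?_, fun d hd => ?_⟩
    · rw [Finset.card_erase_of_mem (by rw [Finset.mem_range]; omega), Finset.card_range]
      omega
    rw [Finset.mem_erase, Finset.mem_range] at hd
    refine ⟨by omega, ?_⟩
    rcases eq_or_ne d (2 * (k - 1 + t)) with rfl | hd2
    · exact gSq
    · exact gPos hh (by omega) (by omega)

end Evaluation

section Code

variable {F : Type} [Field F]

lemma evalCode_twistedPolySet {n k t h : ℕ} (hh : h < k) (η : F) (α v : Fin n → F) :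
    evalCode (twistedPolySet F k t h η) α v =
      LinearMap.range ((evalLM α v ∘ₗ twist h (k - 1 + t) η).domRestrict (degreeLT F k)) := by
  ext c
  constructor
  · rintro ⟨_, ⟨a, rfl⟩, rfl⟩
    refine ⟨⟨∑ i ∈ Finset.range k, C (a i) * X ^ i, ?_⟩, ?_⟩
    · refine Submodule.sum_mem _ fun i hi => mem_degreeLT.2 ?_
      refine (degree_C_mul_X_pow_le _ _).trans_lt ?_
      exact_mod_cast Finset.mem_range.1 hi
    · ext j
      have hcoeff : (∑ i ∈ Finset.range k, C (a i) * X ^ i).coeff h = a h := by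
        simp only [finsetSum_coeff, coeff_C_mul_X_pow]
        simp [hh]
      change evalLM α v (twist h (k - 1 + t) η (∑ i ∈ Finset.range k, C (a i) * X ^ i)) j = _
      rw [evalLM_apply, twist_apply, hcoeff]
  · rintro ⟨⟨f, hf⟩, rfl⟩
    refine ⟨_, ⟨f.coeff, rfl⟩, ?_⟩
    ext j
    rw [mem_degreeLT] at hf
    have hsum : f = ∑ i ∈ Finset.range k, C (f.coeff i) * X ^ i := by
      by_cases h0 : f = 0
      · simp [h0]
      · exact as_sum_range_C_mul_X_pow' _ ((natDegree_lt_iff_degree_lt h0).2 hf)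
    simp [twist_apply, ← hsum]

/-- The square of a GRS code of dimension `k` has dimension at most `2 * k - 1`. -/
lemma twistedCode_ne_grs {n k t h : ℕ} {η : F} (hη : η ≠ 0)
    (ht : 1 ≤ t) (hth : t + h ≤ k - 1) (hk : 3 ≤ k) (hn : 2 * k + t ≤ n + 1)
    (hn' : t ≤ 2 → 2 * k + 2 * t ≤ n + 1) {α : Fin n → F} (hα : Function.Injective α)
    (β w : Fin n → F) :
    evalCode (twistedPolySet F k t h η) α 1 ≠
      evalCode {f : F[X] | f.degree < (k : ℕ)} β w := by
  intro heq
  rw [evalCode_twistedPolySet (by omega)] at heq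
  let S := LinearMap.range ((evalLM β (w * w)).domRestrict (degreeLT F (2 * k - 1)))
  have hS : Module.finrank F S ≤ 2 * k - 1 :=
    (LinearMap.finrank_range_le _).trans (finrank_degreeLT _).le
  have hrep (f : F[X]) (hf : f.degree < k) : ∃ u : F[X], u.degree < k ∧
      ∀ j, (twist h (k - 1 + t) η f).eval (α j) = w j * u.eval (β j) := by
    obtain ⟨u, hu, hfu⟩ := heq.subset ⟨⟨f, mem_degreeLT.2 hf⟩, rfl⟩
    refine ⟨u, hu, fun j => ?_⟩
    simpa using congrFun hfu j
  obtain ⟨D, hcard, hD⟩ := exists_card_degrees_of_twist_mul_mem hη ht hth hk hn hn'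
    (S.comap (evalLM α 1)) (by
      intro f g hf hg
      obtain ⟨u, hu, hfu⟩ := hrep f hf
      obtain ⟨v, hv, hgv⟩ := hrep g hg
      refine ⟨⟨u * v, ?_⟩, ?_⟩
      · rw [mem_degreeLT]
        by_cases h0 : u * v = 0
        · rw [h0, degree_zero]
          exact WithBot.bot_lt_coe _
        rw [← natDegree_lt_iff_degree_lt h0, natDegree_mul (left_ne_zero_of_mul h0)
          (right_ne_zero_of_mul h0)]
        have h1 := (natDegree_lt_iff_degree_lt (left_ne_zero_of_mul h0)).2 hu
        have h2 := (natDegree_lt_iff_degree_lt (right_ne_zero_of_mul h0)).2 hv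
        omega
      · ext j
        simp [hfu, hgv]
        ring)
  have := card_le_finrank_of_degree_eq hα S D (fun d hd => (hD d hd).1) fun d hd => (hD d hd).2
  omega

end Code

theorem stmt_19 (p r m : ℕ) (hp : p.Prime) (hr : 3 ≤ r) (hrm : r ∣ m) (hrm' : r < m)
    (F : Type) [Field F] [Fintype F] [DecidableEq F] (hq : Fintype.card F = p ^ m)
    (n k t h : ℕ) (hn : n = p ^ r)
    (hk : 3 ≤ k) (ht : 1 ≤ t) (hth : t + h ≤ k - 1)
    (E : Subfield F) (hE : Nat.card E = p ^ r)
    (η : F) (hη : η ∉ E)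
    (α : Fin n → F) (hα : Function.Injective α) (hrange : Set.range α = (E : Set F))
    (hcond :
      (t = 1 ∧ 2 * k + t + 2 = p ^ r) ∨
      (Odd t ∧ 3 ≤ t ∧ 2 * k + t = p ^ r) ∨
      (t = 2 ∧ 2 * k + t + 3 = p ^ r) ∨
      (Even t ∧ 4 ≤ t ∧ 2 * k + t + 1 = p ^ r)) :
    SelfOrthogonal (evalCode (twistedPolySet F k t h η) α 1) ∧
    Module.finrank F (Submodule.span F (evalCode (twistedPolySet F k t h η) α 1)) = k ∧
    (∀ c₁ ∈ evalCode (twistedPolySet F k t h η) α 1,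
      ∀ c₂ ∈ evalCode (twistedPolySet F k t h η) α 1,
        c₁ ≠ c₂ → n - k + 1 ≤ hammingDist c₁ c₂) ∧
    (∃ c₁ ∈ evalCode (twistedPolySet F k t h η) α 1,
      ∃ c₂ ∈ evalCode (twistedPolySet F k t h η) α 1,
        c₁ ≠ c₂ ∧ hammingDist c₁ c₂ = n - k + 1) ∧
    (∀ (β w : Fin n → F), Function.Injective β → (∀ j, w j ≠ 0) →
      evalCode (twistedPolySet F k t h η) α 1 ≠
        evalCode {f : Polynomial F | f.degree < (k : ℕ)} β w) := by
  classical
  have := Fintype.ofFinite E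
  rw [Nat.card_eq_fintype_card] at hE
  have hη0 : η ≠ 0 := fun h0 => hη (h0 ▸ E.zero_mem)
  have hbounds : 2 * k + t ≤ n ∧ (t ≤ 2 → 2 * k + 2 * t + 1 ≤ n) ∧
      2 * (k - 1 + t) ≠ n - 1 := by
    subst hn
    rcases hcond with h1 | ⟨h1, h2, h3⟩ | h1 | ⟨⟨s, h1⟩, h2, h3⟩ <;>
    omega
  obtain ⟨hn1, hn2, hn3⟩ := hbounds
  have hαE (j) : α j ∈ E := hrange.subset (Set.mem_range_self j)
  rw [evalCode_twistedPolySet (by omega)]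
  set L := (evalLM α 1 ∘ₗ twist h (k - 1 + t) η).domRestrict (degreeLT F k) with hL
  have hL_apply (f : degreeLT F k) (j) : L f j = (twist h (k - 1 + t) η f).eval (α j) := by
    simp [hL]
  have hzeros (f : degreeLT F k) (hf : f ≠ 0) :
      (Finset.univ.filter fun j => L f j = 0).card < k := by
    by_contra! hcard
    refine hf (Subtype.ext (eq_zero_of_twist_eval_eq_zero E hη (h := h) (N := k - 1 + t) hα hαE
      (mem_degreeLT.1 f.2) _ hcard fun j hj => ?_))
    rw [← hL_apply]
    exact (Finset.mem_filter.1 hj).2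
  have hinj : Function.Injective L := by
    rw [injective_iff_map_eq_zero]
    intro f hf
    by_contra h0
    have := hzeros f h0
    simp [hf] at this
    omega
  have hdist (f g : degreeLT F k) : hammingDist (L f) (L g) +
      (Finset.univ.filter fun j => L (f - g) j = 0).card = n := by
    have := Finset.card_filter_add_card_filter_not (s := (Finset.univ : Finset (Fin n)))
      fun j => L f j = L g j
    simp only [Finset.card_univ, Fintype.card_fin] at this
    simp only [hammingDist, ne_eq, map_sub, Pi.sub_apply, sub_eq_zero]
    omega
  have hmin (f g : degreeLT F k) (hfg : L f ≠ L g) : n - k + 1 ≤ hammingDist (L f) (L g) := by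
    have h1 := hzeros (f - g) (sub_ne_zero.2 fun h0 => hfg (by rw [h0]))
    have h2 := hdist f g
    omega
  refine ⟨?_, ?_, ?_, ?_, fun β w _ _ => ?_⟩
  · rintro _ ⟨f, rfl⟩ _ ⟨g, rfl⟩
    simp only [hL_apply]
    exact sum_twist_mul_twist E hα hrange (by omega) (mem_degreeLT.1 f.2) (mem_degreeLT.1 g.2)
      (by omega) (by omega) (by omega)
  · rw [Submodule.span_eq, LinearMap.finrank_range_of_inj hinj, finrank_degreeLT]
  · rintro _ ⟨f, rfl⟩ _ ⟨g, rfl⟩ hfg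
    exact hmin f g hfg
  · obtain ⟨s, -, hs⟩ := Finset.exists_subset_card_eq
      (s := (Finset.univ : Finset (Fin n))) (n := k - 1) (by simp; omega)
    have hker : LinearMap.ker (LinearMap.funLeft F F ((↑) : s → Fin n) ∘ₗ L) ≠ ⊥ := by
      apply LinearMap.ker_ne_bot_of_finrank_lt
      simp [finrank_degreeLT, hs]
      omega
    obtain ⟨f, hf, hf0⟩ := Submodule.exists_mem_ne_zero_of_ne_bot hker
    have hne : L f ≠ L 0 := fun h0 => hf0 (hinj h0)
    refine ⟨L f, ⟨f, rfl⟩, L 0, ⟨0, rfl⟩, hne, le_antisymm ?_ (hmin f 0 hne)⟩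
    have hsub : s ⊆ Finset.univ.filter fun j => L (f - 0) j = 0 := by
      intro j hj
      have := congrFun (LinearMap.mem_ker.1 hf) ⟨j, hj⟩
      simpa using this
    have h1 := Finset.card_le_card hsub
    have h2 := hdist f 0
    omega
  · rw [← evalCode_twistedPolySet (by omega)]
    exact twistedCode_ne_grs hη0 ht hth hk (by omega) (fun h => by have := hn2 h; omega) hα β w
end
end
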